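/- arXiv:1308.6803 — 2 statements merged into one kernel-verified Lean document; each statement's English description precedes it below -/
import Mathlib

section
/- For every integer n ≥ 1 and every complex number w with w ∉ 2πi·ℤ (so that e^{−w} ≠ 1), the Lindelöf–Wirtinger expansion holds: P_n(e^{−w})/(1 − e^{−w})^{n+1} = n! · ∑_{m=−∞}^{∞} 1/(w + 2πi m)^{n+1}, the series converging absolutely. -/
open Polynomial

/-- The Euler–Frobenius polynomials `P_n`, defined by
`∑_{ν≥0} ν^n z^ν = P_n(z)/(1-z)^{n+1}`, via the equivalent recurrence
`P_0 = 1`, `P_{n+1}(z) = z(1-z)P_n'(z) + (n+1) z P_n(z)`. -/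
noncomputable def eulerFrobenius : ℕ → Polynomial ℂ
  | 0 => 1
  | n + 1 =>
      X * (1 - X) * derivative (eulerFrobenius n) + C ((n : ℂ) + 1) * X * eulerFrobenius n

open Complex in
theorem exp_neg_ne_one_iff {w : ℂ} :
    exp (-w) ≠ 1 ↔ ∀ m : ℤ, w + 2 * Real.pi * I * m ≠ 0 := by
  rw [Ne, exp_eq_one_iff, not_exists]
  refine forall_congr' fun m ↦ not_congr ⟨fun h ↦ ?_, fun h ↦ ?_⟩ <;> linear_combination -h

theorem summable_one_div_add_two_pi_I_mul_pow (w : ℂ) {k : ℕ} (hk : 2 ≤ k) :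
    Summable fun m : ℤ ↦ 1 / (w + 2 * Real.pi * Complex.I * m) ^ k := by
  have hc := Complex.two_pi_I_ne_zero
  refine ((EisensteinSeries.linear_right_summable (w / (2 * Real.pi * Complex.I)) 1
    (k := k) (by exact_mod_cast hk)).mul_left (1 / (2 * Real.pi * Complex.I) ^ k)).congr fun m ↦ ?_
  rw [zpow_natCast, ← one_div, one_div_mul_one_div, ← mul_pow]
  congr 2
  push_cast
  field_simp

theorem isOpen_exp_neg_ne_one : IsOpen {w : ℂ | Complex.exp (-w) ≠ 1} :=
  isOpen_ne_fun (by fun_prop) continuous_const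

theorem isPreconnected_exp_neg_ne_one : IsPreconnected {w : ℂ | Complex.exp (-w) ≠ 1} := by
  have h : (Set.range fun m : ℤ ↦ -(2 * Real.pi * Complex.I * m)).Countable :=
    Set.countable_range _
  convert (h.isConnected_compl_of_one_lt_rank (by simp)).isPreconnected using 1
  ext w
  simp [exp_neg_ne_one_iff, eq_comm, eq_neg_iff_add_eq_zero]

theorem hasDerivAt_tsum_one_div_add_two_pi_I_mul_pow {w : ℂ} (hw : Complex.exp (-w) ≠ 1)
    {k : ℕ} (hk : 2 ≤ k) :
    HasDerivAt (fun w : ℂ ↦ ∑' m : ℤ, 1 / (w + 2 * Real.pi * Complex.I * m) ^ k)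
      (-k * ∑' m : ℤ, 1 / (w + 2 * Real.pi * Complex.I * m) ^ (k + 1)) w := by
  obtain ⟨δ, hδ, hball⟩ := Metric.isOpen_iff.1 isOpen_exp_neg_ne_one w hw
  have hsub : Metric.ball w (δ / 2) ⊆ Metric.ball w δ := Metric.ball_subset_ball (by linarith)
  have hdist (m : ℤ) : δ ≤ ‖w + 2 * Real.pi * Complex.I * m‖ := by
    by_contra! h
    have hmem : -(2 * Real.pi * Complex.I * m) ∈ Metric.ball w δ := by
      rw [Metric.mem_ball, dist_comm, dist_eq_norm, sub_neg_eq_add]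
      exact h
    exact exp_neg_ne_one_iff.1 (hball hmem) m (neg_add_cancel _)
  have hhalf {y : ℂ} (hy : y ∈ Metric.ball w (δ / 2)) (m : ℤ) :
      ‖w + 2 * Real.pi * Complex.I * m‖ / 2 ≤ ‖y + 2 * Real.pi * Complex.I * m‖ := by
    rw [Metric.mem_ball, dist_comm, dist_eq_norm] at hy
    have := norm_sub_norm_le (w + 2 * Real.pi * Complex.I * m) (y + 2 * Real.pi * Complex.I * m)
    rw [add_sub_add_right_eq_sub] at this
    linarith [hdist m]
  rw [← tsum_mul_left]
  refine hasDerivAt_tsum_of_isPreconnected (t := Metric.ball w (δ / 2))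
    (u := fun m : ℤ ↦ k * 2 ^ (k + 1) * ‖1 / (w + 2 * Real.pi * Complex.I * m) ^ (k + 1)‖)
    (g' := fun (m : ℤ) y ↦ -k * (1 / (y + 2 * Real.pi * Complex.I * m) ^ (k + 1)))
    ((summable_one_div_add_two_pi_I_mul_pow w (by lia)).norm.mul_left _) Metric.isOpen_ball
    (convex_ball _ _).isPreconnected (fun m y hy ↦ ?_) (fun m y hy ↦ ?_)
    (Metric.mem_ball_self (half_pos hδ)) (summable_one_div_add_two_pi_I_mul_pow w hk)
    (Metric.mem_ball_self (half_pos hδ))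
  · have hne := exp_neg_ne_one_iff.1 (hball (hsub hy)) m
    obtain ⟨k, rfl⟩ := Nat.exists_eq_add_of_le' hk
    have h := (((hasDerivAt_id y).add_const (2 * Real.pi * Complex.I * m)).pow (k + 2)).inv
      (pow_ne_zero _ hne)
    simp only [one_div]
    refine h.congr_deriv ?_
    simp only [id_eq, Pi.pow_apply]
    field_simp
    rw [show k + 2 - 1 = k + 1 from rfl]
    ring
  · have hpos : 0 < ‖w + 2 * Real.pi * Complex.I * m‖ := hδ.trans_le (hdist m)
    rw [norm_mul, norm_neg, Complex.norm_natCast, mul_assoc (k : ℝ), norm_div, norm_div, norm_pow, norm_pow,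
      norm_one, show (2 : ℝ) ^ (k + 1) * (1 / ‖w + 2 * Real.pi * Complex.I * m‖ ^ (k + 1)) =
        1 / (‖w + 2 * Real.pi * Complex.I * m‖ / 2) ^ (k + 1) by rw [div_pow]; field_simp]
    gcongr
    exact hhalf hy m

theorem exp_neg_div_sq_eq_tsum_of_re_pos {w : ℂ} (hw : 0 < w.re) :
    Complex.exp (-w) / (1 - Complex.exp (-w)) ^ 2 =
      ∑' m : ℤ, 1 / (w + 2 * Real.pi * Complex.I * m) ^ 2 := by
  have hc := Complex.two_pi_I_ne_zero
  have him : 0 < (-w / (2 * Real.pi * Complex.I)).im := by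
    have : -w / (2 * Real.pi * Complex.I) = ((1 / (2 * Real.pi) : ℝ) : ℂ) * (Complex.I * w) := by
      push_cast
      field_simp
      simp
    rw [this, Complex.im_ofReal_mul, Complex.I_mul_im]
    positivity
  have h := EisensteinSeries.qExpansion_identity le_rfl ⟨_, him⟩
  simp only [pow_one, mul_div_cancel₀ _ hc] at h
  have hlt : ‖Complex.exp (-w)‖ < 1 := by simpa [Complex.norm_exp] using hw
  rw [tsum_coe_mul_geometric_of_norm_lt_one hlt] at h
  have h2 : (-2 * Real.pi * Complex.I) ^ 2 ≠ 0 := by simp [Real.pi_ne_zero]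
  rw [← mul_right_inj' h2]
  simp only [Nat.factorial_one, Nat.cast_one, div_one, one_add_one_eq_two] at h
  rw [← h, ← (Equiv.neg ℤ).tsum_eq, ← tsum_mul_left]
  refine tsum_congr fun m ↦ ?_
  rw [show w + 2 * Real.pi * Complex.I * m = -2 * Real.pi * Complex.I *
    (-w / (2 * Real.pi * Complex.I) + (Equiv.neg ℤ m : ℤ)) by
      simp only [Equiv.neg_apply, Int.cast_neg]; field_simp; ring, mul_pow _ (_ + _),
      ← mul_div_assoc, mul_one, div_mul_cancel_left₀ h2, one_div]

theorem exp_neg_div_sq_eq_tsum {w : ℂ} (hw : Complex.exp (-w) ≠ 1) :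
    Complex.exp (-w) / (1 - Complex.exp (-w)) ^ 2 =
      ∑' m : ℤ, 1 / (w + 2 * Real.pi * Complex.I * m) ^ 2 := by
  have hf : AnalyticOnNhd ℂ (fun w ↦ Complex.exp (-w) / (1 - Complex.exp (-w)) ^ 2)
      {w : ℂ | Complex.exp (-w) ≠ 1} := by
    refine DifferentiableOn.analyticOnNhd (fun w hw ↦ ?_) isOpen_exp_neg_ne_one
    have : (1 - Complex.exp (-w)) ^ 2 ≠ 0 := pow_ne_zero _ (sub_ne_zero.2 (Ne.symm hw))
    exact DifferentiableAt.differentiableWithinAt (by fun_prop (disch := assumption))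
  have hg : AnalyticOnNhd ℂ (fun w : ℂ ↦ ∑' m : ℤ, 1 / (w + 2 * Real.pi * Complex.I * m) ^ 2)
      {w : ℂ | Complex.exp (-w) ≠ 1} :=
    DifferentiableOn.analyticOnNhd (fun w hw ↦ (hasDerivAt_tsum_one_div_add_two_pi_I_mul_pow hw
      le_rfl).differentiableAt.differentiableWithinAt) isOpen_exp_neg_ne_one
  have hone : (1 : ℂ) ∈ {w : ℂ | Complex.exp (-w) ≠ 1} := fun h ↦ by
    have := congrArg norm h
    simp [Complex.norm_exp] at this
  refine hf.eqOn_of_preconnected_of_eventuallyEq hg isPreconnected_exp_neg_ne_one hone ?_ hw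
  filter_upwards [(isOpen_lt continuous_const Complex.continuous_re).mem_nhds
    (show (0 : ℝ) < (1 : ℂ).re by simp)] with z hz
  exact exp_neg_div_sq_eq_tsum_of_re_pos hz

theorem hasDerivAt_eval_eulerFrobenius_div (n : ℕ) {w : ℂ} (hw : Complex.exp (-w) ≠ 1) :
    HasDerivAt
      (fun w ↦ (eulerFrobenius n).eval (Complex.exp (-w)) / (1 - Complex.exp (-w)) ^ (n + 1))
      (-((eulerFrobenius (n + 1)).eval (Complex.exp (-w)) / (1 - Complex.exp (-w)) ^ (n + 2)))
      w := by
  have hne : 1 - Complex.exp (-w) ≠ 0 := sub_ne_zero.2 (Ne.symm hw)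
  have he : HasDerivAt (fun w ↦ Complex.exp (-w)) (-Complex.exp (-w)) w := by
    simpa using (hasDerivAt_neg w).cexp
  have hnum := ((eulerFrobenius n).hasDerivAt (Complex.exp (-w))).comp w he
  refine (hnum.div ((he.const_sub 1).pow (n + 1)) (pow_ne_zero _ hne)).congr_deriv ?_
  simp only [eulerFrobenius, eval_add, eval_mul, eval_sub, eval_one, eval_X, eval_C,
    Function.comp_apply, Pi.pow_apply, Nat.add_sub_cancel]
  field_simp
  push_cast
  ring

theorem eval_eulerFrobenius_div_eq_tsum {n : ℕ} (hn : 1 ≤ n) {w : ℂ} (hw : Complex.exp (-w) ≠ 1) :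
    (eulerFrobenius n).eval (Complex.exp (-w)) / (1 - Complex.exp (-w)) ^ (n + 1) =
      (Nat.factorial n : ℂ) * ∑' m : ℤ, 1 / (w + 2 * Real.pi * Complex.I * m) ^ (n + 1) := by
  induction n, hn using Nat.le_induction generalizing w with
  | base => simpa [eulerFrobenius] using exp_neg_div_sq_eq_tsum hw
  | succ n hn ih =>
    have hr := (hasDerivAt_tsum_one_div_add_two_pi_I_mul_pow hw (k := n + 1)
      (by lia)).const_mul (Nat.factorial n : ℂ)
    have heq := Filter.eventuallyEq_of_mem (isOpen_exp_neg_ne_one.mem_nhds hw) fun z hz ↦ ih hz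
    have h := (hasDerivAt_eval_eulerFrobenius_div n hw).unique (hr.congr_of_eventuallyEq heq)
    rw [Nat.factorial_succ]
    push_cast at h ⊢
    linear_combination -h

/-- Lindelöf–Wirtinger expansion: for `n ≥ 1` and `w ∉ 2πi·ℤ`,
`P_n(e^{-w})/(1-e^{-w})^{n+1} = n! ∑_{m ∈ ℤ} (w + 2πi m)^{-(n+1)}`,
the series converging absolutely. -/
theorem lindelof_wirtinger (n : ℕ) (hn : 1 ≤ n) (w : ℂ)
    (hw : ∀ m : ℤ, w ≠ 2 * Real.pi * Complex.I * m) :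
    Summable (fun m : ℤ => ‖1 / (w + 2 * Real.pi * Complex.I * m) ^ (n + 1)‖) ∧
    (eulerFrobenius n).eval (Complex.exp (-w)) / (1 - Complex.exp (-w)) ^ (n + 1) =
      (Nat.factorial n : ℂ) * ∑' m : ℤ, 1 / (w + 2 * Real.pi * Complex.I * m) ^ (n + 1) := by
  refine ⟨(summable_one_div_add_two_pi_I_mul_pow w (by lia)).norm,
    eval_eulerFrobenius_div_eq_tsum hn (exp_neg_ne_one_iff.2 fun m h ↦ hw (-m) ?_)⟩
  push_cast
  linear_combination h
end

section
/- Let ω := 2 log((√5 + 1)/2), a_n' := (2n+1)/(√5 ω) − 2/5, b_n' := ( 1/(5ω²) − 2/(5√5 ω) ) (2n+1) − 2/25, and c_n' := (2√n / (5 √(b_n') ω)³) · { (2√5 ω² − 30ω + 10√5) n + 3ω³ + √5 ω² − 15ω + 5√5 }. Then, uniformly in j ∈ ℤ, ( √(5 b_n') (2j)! ω^{2n+1} / (2 (2n)!) ) · {n j}_{1/2} = (1/√(2π)) e^{−x²/2} ( 1 + c_n' (x³ − 3x)/(6√n) ) + o(1/√n) as n → ∞, where x = (j − a_n')/√(b_n').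 Equivalently: √n · sup_{j ∈ ℤ} | ( √(5 b_n') (2j)! ω^{2n+1} / (2 (2n)!) ) {n j}_{1/2} − (1/√(2π)) e^{−x_j²/2} ( 1 + c_n' (x_j³ − 3x_j)/(6√n) ) | → 0 as n → ∞, with x_j := (j − a_n')/√(b_n'). -/
/-- The Chebyshev-Stirling numbers of the second kind `{n j}_{1/2}`, defined by the recurrence
`{n j}_{1/2} = {n-1 j-1}_{1/2} + j² {n-1 j}_{1/2}`, `{n 0}_{1/2} = δ_{n,0}`,
`{0 j}_{1/2} = δ_{0,j}` (and `{n j}_{1/2} = 0` for integers `j < 0`, captured below by `if`). -/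
def chebyshevStirling : ℕ → ℕ → ℕ
  | 0, 0 => 1
  | 0, _ + 1 => 0
  | _ + 1, 0 => 0
  | n + 1, j + 1 => chebyshevStirling n j + (j + 1) ^ 2 * chebyshevStirling n (j + 1)

/-- `ω = 2 log((√5 + 1)/2)`. -/
noncomputable def ω : ℝ := 2 * Real.log ((Real.sqrt 5 + 1) / 2)

/-- `a_n' = (2n+1)/(√5 ω) - 2/5`. -/
noncomputable def a' (n : ℕ) : ℝ := (2 * (n : ℝ) + 1) / (Real.sqrt 5 * ω) - 2 / 5

/-- `b_n' = (1/(5ω²) - 2/(5√5 ω))(2n+1) - 2/25`. -/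
noncomputable def b' (n : ℕ) : ℝ :=
  (1 / (5 * ω ^ 2) - 2 / (5 * Real.sqrt 5 * ω)) * (2 * (n : ℝ) + 1) - 2 / 25

/-- `c_n' = (2√n/(5√(b_n')ω)³)((2√5 ω² - 30ω + 10√5)n + 3ω³ + √5 ω² - 15ω + 5√5)`. -/
noncomputable def c' (n : ℕ) : ℝ :=
  2 * Real.sqrt n / (5 * Real.sqrt (b' n) * ω) ^ 3 *
    ((2 * Real.sqrt 5 * ω ^ 2 - 30 * ω + 10 * Real.sqrt 5) * (n : ℝ) +
      3 * ω ^ 3 + Real.sqrt 5 * ω ^ 2 - 15 * ω + 5 * Real.sqrt 5)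

/-- `x = (j - a_n')/√(b_n')`. -/
noncomputable def x (n : ℕ) (j : ℤ) : ℝ := ((j : ℝ) - a' n) / Real.sqrt (b' n)

/-- The normalized Chebyshev-Stirling quantity `√(5 b_n') (2j)! ω^{2n+1} {n j}_{1/2} / (2(2n)!)`
(equal to `0` for integers `j < 0`, since then `{n j}_{1/2} = 0`). -/
noncomputable def normalizedCheb (n : ℕ) (j : ℤ) : ℝ :=
  if 0 ≤ j then
    Real.sqrt (5 * b' n) * (Nat.factorial (2 * j.toNat) : ℝ) * ω ^ (2 * n + 1) /
      (2 * (Nat.factorial (2 * n) : ℝ)) * (chebyshevStirling n j.toNat : ℝ)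
  else 0

/-- The Taylor coefficients in `t²` of `2 cosh t - 2`. -/
noncomputable def coshCoeff (k : ℕ) : ℝ := if k = 0 then 0 else 2 / ((2 * k).factorial : ℝ)

lemma coshCoeff_zero : coshCoeff 0 = 0 := by simp [coshCoeff]

lemma coshCoeff_succ (k : ℕ) : coshCoeff (k + 1) = 2 / ((2 * (k + 1)).factorial : ℝ) := by
  simp [coshCoeff]

lemma coshCoeff_nonneg (k : ℕ) : 0 ≤ coshCoeff k := by
  unfold coshCoeff; split_ifs <;> positivity

lemma coshCoeff_succ_succ (k : ℕ) :
    (2 * (k : ℝ) + 4) * (2 * k + 3) * coshCoeff (k + 2) = coshCoeff (k + 1) := by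
  rw [coshCoeff_succ, coshCoeff_succ, show 2 * (k + 1 + 1) = 2 * (k + 1) + 1 + 1 by ring,
    Nat.factorial_succ, Nat.factorial_succ]
  push_cast
  field_simp
  ring

lemma coshCoeff_succ_le (k : ℕ) : coshCoeff (k + 1) ≤ (1 / 8) ^ k := by
  induction k with
  | zero => norm_num [coshCoeff_succ, Nat.factorial]
  | succ k ih =>
    have h := coshCoeff_succ_succ k
    have h0 := coshCoeff_nonneg (k + 2)
    have hk : (0 : ℝ) ≤ k := k.cast_nonneg
    have : 8 * coshCoeff (k + 2) ≤ coshCoeff (k + 1) := by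
      rw [← h]
      exact mul_le_mul_of_nonneg_right (by nlinarith) h0
    rw [pow_succ]
    linarith

/-- The power series of `2 cosh t - 2` in `t²`. -/
noncomputable def coshSeries : PowerSeries ℝ := PowerSeries.mk coshCoeff

open PowerSeries in
lemma coshSeries_ode :
    4 * X * d⁄dX ℝ (d⁄dX ℝ coshSeries) + 2 * d⁄dX ℝ coshSeries = coshSeries + 2 := by
  have h2 : (2 : PowerSeries ℝ) = C 2 := (map_ofNat C 2).symm
  have h4 : (4 : PowerSeries ℝ) = C 4 := (map_ofNat C 4).symm
  rw [h2, h4, mul_assoc]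
  ext n
  cases n with
  | zero =>
    rw [coeff_zero_eq_constantCoeff_apply, coeff_zero_eq_constantCoeff_apply]
    have h0 : constantCoeff (d⁄dX ℝ coshSeries) = 1 := by
      rw [← coeff_zero_eq_constantCoeff_apply, coeff_derivative]
      simp [coshSeries, coshCoeff]
    simp [h0]
    simp [coshSeries, coshCoeff]
  | succ n =>
    simp only [map_add, coeff_C_mul, coeff_succ_X_mul, coeff_derivative, coshSeries, coeff_mk,
      coeff_C]
    have := coshCoeff_succ_succ n
    push_cast
    simp
    linear_combination this

open PowerSeries in
lemma coshSeries_ode_sq :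
    4 * X * (d⁄dX ℝ coshSeries) ^ 2 = coshSeries ^ 2 + 4 * coshSeries := by
  apply derivative.ext
  · have h := coshSeries_ode
    have h4 : (4 : PowerSeries ℝ) = C 4 := (map_ofNat C 4).symm
    have h4d : d⁄dX ℝ (4 : PowerSeries ℝ) = 0 := by rw [h4]; exact derivative_C
    simp only [Derivation.leibniz, map_add, Derivation.leibniz_pow, smul_eq_mul, nsmul_eq_mul,
      h4d, derivative_X]
    push_cast
    linear_combination 2 * (d⁄dX ℝ coshSeries) * h
  · simp [coshSeries, coshCoeff]

open PowerSeries in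
lemma coshSeries_pow_ode (j : ℕ) :
    4 * X * d⁄dX ℝ (d⁄dX ℝ (coshSeries ^ (j + 1))) + 2 * d⁄dX ℝ (coshSeries ^ (j + 1)) =
      ((j : PowerSeries ℝ) + 1) ^ 2 * coshSeries ^ (j + 1) +
        (2 * (j : PowerSeries ℝ) + 2) * (2 * (j : PowerSeries ℝ) + 1) * coshSeries ^ j := by
  have h := coshSeries_ode
  have h' := coshSeries_ode_sq
  have hc (k : ℕ) : d⁄dX ℝ (k : PowerSeries ℝ) = 0 := Derivation.map_natCast _ _
  cases j with
  | zero =>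
    simp only [Nat.cast_zero, zero_add, pow_one, pow_zero]
    linear_combination h
  | succ i =>
    simp only [Derivation.leibniz, Derivation.leibniz_pow, smul_eq_mul, nsmul_eq_mul, hc,
      Nat.add_sub_cancel]
    push_cast
    linear_combination ((i : PowerSeries ℝ) + 2) * coshSeries ^ (i + 1) * h +
      ((i : PowerSeries ℝ) + 2) * (i + 1) * coshSeries ^ i * h'

open PowerSeries in
lemma coeff_coshSeries_pow_succ (n j : ℕ) :
    (2 * (n : ℝ) + 2) * (2 * n + 1) * coeff (n + 1) (coshSeries ^ (j + 1)) =
      ((j : ℝ) + 1) ^ 2 * coeff n (coshSeries ^ (j + 1)) +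
        (2 * j + 2) * (2 * j + 1) * coeff n (coshSeries ^ j) := by
  have h := congrArg (coeff n) (coshSeries_pow_ode j)
  have e1 : ((j : PowerSeries ℝ) + 1) ^ 2 = C (((j : ℝ) + 1) ^ 2) := by simp
  have e2 : (2 * (j : PowerSeries ℝ) + 2) * (2 * j + 1) = C ((2 * (j : ℝ) + 2) * (2 * j + 1)) := by
    simp only [map_add, map_mul, map_one, map_natCast, map_ofNat]
  have h2 : (2 : PowerSeries ℝ) = C 2 := (map_ofNat C 2).symm
  have h4 : (4 : PowerSeries ℝ) = C 4 := (map_ofNat C 4).symm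
  rw [e1, e2, h2, h4, mul_assoc (C 4)] at h
  simp only [map_add, coeff_C_mul, coeff_derivative] at h
  rw [← h]
  cases n with
  | zero => simp
  | succ n =>
    simp only [coeff_succ_X_mul, coeff_derivative]
    push_cast
    ring

/-- The scaled Chebyshev-Stirling numbers `(2j)! {n j}_{1/2} / (2n)!`. -/
noncomputable def scaledCheb (n j : ℕ) : ℝ :=
  ((2 * j).factorial : ℝ) * chebyshevStirling n j / ((2 * n).factorial : ℝ)

open PowerSeries in
lemma scaledCheb_eq_coeff (n j : ℕ) : scaledCheb n j = coeff n (coshSeries ^ j) := by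
  induction n generalizing j with
  | zero =>
    cases j with
    | zero => simp [scaledCheb, chebyshevStirling]
    | succ j => simp [scaledCheb, chebyshevStirling, coshSeries, coshCoeff]
  | succ n ih =>
    cases j with
    | zero => simp [scaledCheb, chebyshevStirling, coeff_one]
    | succ j =>
      have h := coeff_coshSeries_pow_succ n j
      rw [← ih, ← ih] at h
      have hn : (2 * (n : ℝ) + 2) * (2 * n + 1) ≠ 0 := by positivity
      apply mul_left_cancel₀ hn
      rw [h]
      simp only [scaledCheb, chebyshevStirling]
      rw [show 2 * (n + 1) = 2 * n + 1 + 1 by ring, show 2 * (j + 1) = 2 * j + 1 + 1 by ring]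
      simp only [Nat.factorial_succ]
      push_cast
      field_simp
      ring

lemma scaledCheb_of_lt {n j : ℕ} (h : n < j) : scaledCheb n j = 0 := by
  rw [scaledCheb_eq_coeff]
  apply PowerSeries.coeff_of_lt_order
  refine lt_of_lt_of_le (by exact_mod_cast h)
    (PowerSeries.le_order_pow_of_constantCoeff_eq_zero j ?_)
  simp [coshSeries, coshCoeff]

lemma scaledCheb_zero_right (n : ℕ) : scaledCheb n 0 = if n = 0 then 1 else 0 := by
  simp [scaledCheb_eq_coeff, PowerSeries.coeff_one]

lemma scaledCheb_succ_right (n j : ℕ) :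
    scaledCheb n (j + 1) =
      ∑ p ∈ Finset.HasAntidiagonal.antidiagonal n, coshCoeff p.1 * scaledCheb p.2 j := by
  simp [scaledCheb_eq_coeff, pow_succ', PowerSeries.coeff_mul, coshSeries]

/-- The generating polynomial of the scaled Chebyshev-Stirling numbers. -/
noncomputable def chebPoly (n : ℕ) (y : ℂ) : ℂ :=
  ∑ j ∈ Finset.range (n + 1), (scaledCheb n j : ℂ) * y ^ j

lemma chebPoly_eq_sum {n N : ℕ} (h : n < N) (y : ℂ) :
    chebPoly n y = ∑ j ∈ Finset.range N, (scaledCheb n j : ℂ) * y ^ j := by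
  refine Finset.sum_subset (Finset.range_mono h) fun j _ hj => ?_
  rw [scaledCheb_of_lt (by simpa using hj)]
  simp

lemma chebPoly_renewal (n : ℕ) (y : ℂ) :
    chebPoly n y = (if n = 0 then 1 else 0) +
      y * ∑ p ∈ Finset.HasAntidiagonal.antidiagonal n, (coshCoeff p.1 : ℂ) * chebPoly p.2 y := by
  rw [chebPoly_eq_sum (show n < n + 1 + 1 by omega), Finset.sum_range_succ', add_comm]
  congr 1
  · rw [scaledCheb_zero_right]; split_ifs <;> simp
  · have h : ∀ p ∈ Finset.HasAntidiagonal.antidiagonal n, (coshCoeff p.1 : ℂ) * chebPoly p.2 y =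
        ∑ j ∈ Finset.range (n + 1), (coshCoeff p.1 : ℂ) * ((scaledCheb p.2 j : ℂ) * y ^ j) := by
      intro p hp
      have := Finset.HasAntidiagonal.mem_antidiagonal.1 hp
      rw [chebPoly_eq_sum (show p.2 < n + 1 by omega), Finset.mul_sum]
    rw [Finset.sum_congr rfl h, Finset.sum_comm, Finset.mul_sum]
    refine Finset.sum_congr rfl fun j _ => ?_
    rw [scaledCheb_succ_right]
    push_cast
    rw [Finset.sum_mul, Finset.mul_sum]
    refine Finset.sum_congr rfl fun p _ => ?_
    ring

/-- The coefficients in `s` of `(g ρ - g s) / (ρ - s)`, where `g t² = 2 cosh t - 2`. -/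
noncomputable def slopeCoeff (ρ : ℂ) (m : ℕ) : ℂ := ∑' k, (coshCoeff (m + 1 + k) : ℂ) * ρ ^ k

lemma norm_coshCoeff_mul_pow_le {ρ : ℂ} (hρ : ‖ρ‖ ≤ 1) (m k : ℕ) :
    ‖(coshCoeff (m + 1 + k) : ℂ) * ρ ^ k‖ ≤ (1 / 8) ^ m * (1 / 8) ^ k := by
  rw [norm_mul, norm_pow, Complex.norm_real, Real.norm_of_nonneg (coshCoeff_nonneg _), ← pow_add,
    show m + 1 + k = m + k + 1 by ring]
  calc _ ≤ coshCoeff (m + k + 1) * 1 :=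
        mul_le_mul_of_nonneg_left (pow_le_one₀ (norm_nonneg _) hρ) (coshCoeff_nonneg _)
    _ ≤ _ := by rw [mul_one]; exact coshCoeff_succ_le _

lemma hasSum_eighth (m : ℕ) :
    HasSum (fun k : ℕ => (1 / 8 : ℝ) ^ m * (1 / 8) ^ k) (8 / 7 * (1 / 8) ^ m) := by
  have := (hasSum_geometric_of_lt_one (r := (1 / 8 : ℝ)) (by norm_num) (by norm_num)).mul_left
    ((1 / 8 : ℝ) ^ m)
  rwa [show (1 - 1 / 8 : ℝ)⁻¹ = 8 / 7 by norm_num, mul_comm _ (8 / 7 : ℝ)] at this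

lemma summable_slopeCoeff {ρ : ℂ} (hρ : ‖ρ‖ ≤ 1) (m : ℕ) :
    Summable fun k => (coshCoeff (m + 1 + k) : ℂ) * ρ ^ k :=
  Summable.of_norm_bounded (hasSum_eighth m).summable (norm_coshCoeff_mul_pow_le hρ m)

lemma norm_slopeCoeff_le {ρ : ℂ} (hρ : ‖ρ‖ ≤ 1) (m : ℕ) :
    ‖slopeCoeff ρ m‖ ≤ 8 / 7 * (1 / 8) ^ m :=
  tsum_of_norm_bounded (hasSum_eighth m) (norm_coshCoeff_mul_pow_le hρ m)

lemma slopeCoeff_eq {ρ : ℂ} (hρ : ‖ρ‖ ≤ 1) (m : ℕ) :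
    slopeCoeff ρ m = coshCoeff (m + 1) + ρ * slopeCoeff ρ (m + 1) := by
  rw [slopeCoeff, (summable_slopeCoeff hρ m).tsum_eq_zero_add, slopeCoeff, ← tsum_mul_left]
  simp only [add_zero, pow_zero, mul_one]
  congr 1
  refine tsum_congr fun k => ?_
  rw [show m + 1 + (k + 1) = m + 1 + 1 + k by ring]
  ring

lemma hasSum_coshCoeff (r : ℂ) :
    HasSum (fun k : ℕ => (coshCoeff (k + 1) : ℂ) * (r ^ 2) ^ (k + 1)) (2 * Complex.cosh r - 2) := by
  have h := (hasSum_nat_add_iff' 1).2 ((Complex.hasSum_cosh r).mul_left 2)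
  rw [show 2 * Complex.cosh r - ∑ i ∈ Finset.range 1, 2 * (r ^ (2 * i) / ((2 * i).factorial : ℂ)) =
    2 * Complex.cosh r - 2 by simp] at h
  refine h.congr_fun fun k => ?_
  rw [coshCoeff_succ, ← pow_mul]
  push_cast
  ring

lemma mul_slopeCoeff_zero {ρ r : ℂ} (hr : r ^ 2 = ρ) :
    ρ * slopeCoeff ρ 0 = 2 * Complex.cosh r - 2 := by
  rw [← (hasSum_coshCoeff r).tsum_eq, slopeCoeff, ← tsum_mul_left, hr]
  refine tsum_congr fun k => ?_
  rw [show 0 + 1 + k = k + 1 by ring]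
  ring

lemma hasSum_coshCoeff_deriv {r : ℂ} (hr : r ≠ 0) :
    HasSum (fun k : ℕ => (k + 1 : ℂ) * coshCoeff (k + 1) * (r ^ 2) ^ k) (Complex.sinh r / r) := by
  have h := (Complex.hasSum_sinh r).div_const r
  refine h.congr_fun fun k => ?_
  rw [coshCoeff_succ, ← pow_mul, show 2 * (k + 1) = 2 * k + 1 + 1 by ring, Nat.factorial_succ]
  push_cast
  rw [show 2 * (k : ℂ) + 1 + 1 = 2 * (k + 1) by ring]
  have : (k : ℂ) + 1 ≠ 0 := k.cast_add_one_ne_zero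
  have h2 : ((2 * k + 1).factorial : ℂ) ≠ 0 := by exact_mod_cast (Nat.factorial_pos _).ne'
  field_simp
  rw [pow_succ]

lemma sum_coshCoeff_deriv {ρ : ℂ} (hρ : ‖ρ‖ ≤ 1) (M : ℕ) :
    ∑ k ∈ Finset.range M, (k + 1 : ℂ) * coshCoeff (k + 1) * ρ ^ k =
      ∑ k ∈ Finset.range M, slopeCoeff ρ k * ρ ^ k - M * (slopeCoeff ρ M * ρ ^ M) := by
  induction M with
  | zero => simp
  | succ M ih =>
    rw [Finset.sum_range_succ, Finset.sum_range_succ, ih]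
    have := slopeCoeff_eq hρ M
    push_cast
    rw [pow_succ]
    linear_combination -((M : ℂ) + 1) * ρ ^ M * this

lemma norm_slopeCoeff_mul_pow_le {ρ : ℂ} (hρ : ‖ρ‖ ≤ 1) (m : ℕ) :
    ‖slopeCoeff ρ m * ρ ^ m‖ ≤ 8 / 7 * (1 / 8) ^ m := by
  rw [norm_mul, norm_pow]
  exact (mul_le_of_le_one_right (norm_nonneg _) (pow_le_one₀ (norm_nonneg _) hρ)).trans
    (norm_slopeCoeff_le hρ m)

lemma summable_norm_slopeCoeff_mul_pow {ρ : ℂ} (hρ : ‖ρ‖ ≤ 1) :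
    Summable fun m => ‖slopeCoeff ρ m * ρ ^ m‖ :=
  Summable.of_nonneg_of_le (fun _ => norm_nonneg _) (norm_slopeCoeff_mul_pow_le hρ)
    ((summable_geometric_of_lt_one (by norm_num) (by norm_num)).mul_left _)

lemma tsum_slopeCoeff_mul_pow {ρ r : ℂ} (hρ : ‖ρ‖ ≤ 1) (hr : r ^ 2 = ρ) (hr0 : r ≠ 0) :
    ∑' m, slopeCoeff ρ m * ρ ^ m = Complex.sinh r / r := by
  have h1 := (hasSum_coshCoeff_deriv hr0).tendsto_sum_nat
  rw [hr] at h1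
  simp_rw [sum_coshCoeff_deriv hρ] at h1
  have h2 := (summable_norm_slopeCoeff_mul_pow hρ).of_norm.hasSum.tendsto_sum_nat
  have h3 : Filter.Tendsto (fun M : ℕ => (M : ℂ) * (slopeCoeff ρ M * ρ ^ M)) Filter.atTop
      (nhds 0) := by
    have h4 := (tendsto_self_mul_const_pow_of_lt_one (r := (1 / 8 : ℝ)) (by norm_num)
      (by norm_num)).const_mul (8 / 7)
    rw [mul_zero] at h4
    refine squeeze_zero_norm (fun M => ?_) h4
    rw [norm_mul, Complex.norm_natCast]
    have := mul_le_mul_of_nonneg_left (norm_slopeCoeff_mul_pow_le hρ M) (M.cast_nonneg (α := ℝ))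
    linarith
  have h5 := tendsto_nhds_unique h1 (h2.sub h3)
  rw [sub_zero] at h5
  exact h5.symm

/-- The coefficients in `s` of `(ρ - s) F(s)`, where `F` is the generating function of the
polynomials `chebPoly · y`. -/
noncomputable def poleFreeCoeff (y ρ : ℂ) (n : ℕ) : ℂ :=
  PowerSeries.coeff n ((PowerSeries.C ρ - PowerSeries.X) * PowerSeries.mk fun n => chebPoly n y)

lemma sum_poleFreeCoeff_mul_pow (y ρ : ℂ) (n : ℕ) :
    ∑ m ∈ Finset.range (n + 1), poleFreeCoeff y ρ m * ρ ^ m = chebPoly n y * ρ ^ (n + 1) := by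
  induction n with
  | zero => simp [poleFreeCoeff, mul_comm]
  | succ n ih =>
    rw [Finset.sum_range_succ, ih]
    simp only [poleFreeCoeff, sub_mul, map_sub, PowerSeries.coeff_C_mul,
      PowerSeries.coeff_succ_X_mul, PowerSeries.coeff_mk]
    ring

lemma sum_slopeCoeff_mul_poleFreeCoeff {y ρ r : ℂ} (hρ : ‖ρ‖ ≤ 1) (hr : r ^ 2 = ρ)
    (hy : y * (2 * Complex.cosh r - 2) = 1) (n : ℕ) :
    y * ∑ p ∈ Finset.HasAntidiagonal.antidiagonal n, slopeCoeff ρ p.1 * poleFreeCoeff y ρ p.2 =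
      if n = 0 then 1 else 0 := by
  set F : PowerSeries ℂ := PowerSeries.mk fun n => chebPoly n y with hF
  set G : PowerSeries ℂ := PowerSeries.mk fun n => (coshCoeff n : ℂ) with hG
  set Q : PowerSeries ℂ := PowerSeries.mk (slopeCoeff ρ) with hQ
  have h1 : F = 1 + PowerSeries.C y * (G * F) := by
    ext n
    rw [map_add, PowerSeries.coeff_C_mul, PowerSeries.coeff_mul, PowerSeries.coeff_one]
    simp only [hF, hG, PowerSeries.coeff_mk]
    exact chebPoly_renewal n y
  have h2 : PowerSeries.C y * ((PowerSeries.C ρ - PowerSeries.X) * Q) =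
      1 - PowerSeries.C y * G := by
    ext n
    rw [sub_mul]
    cases n with
    | zero =>
      simp only [map_sub, PowerSeries.coeff_C_mul, PowerSeries.coeff_zero_X_mul,
        hQ, hG, PowerSeries.coeff_mk, PowerSeries.coeff_one, mul_slopeCoeff_zero hr,
        coshCoeff_zero]
      simpa using hy
    | succ n =>
      simp only [map_sub, PowerSeries.coeff_C_mul, PowerSeries.coeff_succ_X_mul,
        hQ, hG, PowerSeries.coeff_mk, PowerSeries.coeff_one, slopeCoeff_eq hρ n]
      simp
  have h3 : PowerSeries.C y * (Q * ((PowerSeries.C ρ - PowerSeries.X) * F)) = 1 := by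
    linear_combination F * h2 + h1
  have h4 := congrArg (PowerSeries.coeff n) h3
  rw [PowerSeries.coeff_C_mul, PowerSeries.coeff_mul, PowerSeries.coeff_one] at h4
  simpa only [hQ, PowerSeries.coeff_mk, poleFreeCoeff] using h4

lemma norm_poleFreeCoeff_le {y ρ r : ℂ} (hn : ‖y‖ = 1) (hρ : ‖ρ‖ ≤ 1) (hr : r ^ 2 = ρ)
    (hy : y * (2 * Complex.cosh r - 2) = 1) (n : ℕ) :
    ‖poleFreeCoeff y ρ n‖ ≤ (1 / 2) ^ n := by
  have hQ0 : 1 ≤ ‖slopeCoeff ρ 0‖ := by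
    rw [← mul_slopeCoeff_zero hr] at hy
    have h := congrArg norm hy
    rw [norm_mul, norm_mul, hn, one_mul, norm_one] at h
    nlinarith [norm_nonneg (slopeCoeff ρ 0), norm_nonneg ρ]
  induction n using Nat.strong_induction_on with
  | _ n ih =>
    cases n with
    | zero => simpa [poleFreeCoeff, chebPoly, scaledCheb_zero_right] using hρ
    | succ n =>
      have h := sum_slopeCoeff_mul_poleFreeCoeff hρ hr hy (n + 1)
      have hy0 : y ≠ 0 := fun h0 => by simp [h0] at hn
      rw [if_neg n.succ_ne_zero, mul_eq_zero, or_iff_right hy0,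
        Finset.Nat.sum_antidiagonal_eq_sum_range_succ
          (fun i j => slopeCoeff ρ i * poleFreeCoeff y ρ j), Finset.sum_range_succ',
        Nat.sub_zero] at h
      have h' : ‖slopeCoeff ρ 0 * poleFreeCoeff y ρ (n + 1)‖ ≤
          ∑ k ∈ Finset.range (n + 1), 8 / 7 * (1 / 8) * (1 / 2) ^ n * (1 / 4 : ℝ) ^ k := by
        rw [eq_neg_of_add_eq_zero_right h, norm_neg]
        refine norm_sum_le_of_le _ fun k hk => ?_
        have hk' : k ≤ n := by simpa [Nat.lt_succ_iff] using hk
        rw [norm_mul, show n + 1 - (k + 1) = n - k by omega]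
        calc _ ≤ 8 / 7 * (1 / 8) ^ (k + 1) * (1 / 2 : ℝ) ^ (n - k) :=
              mul_le_mul (norm_slopeCoeff_le hρ _) (ih _ (by omega)) (norm_nonneg _)
                (by positivity)
          _ = _ := by
              obtain ⟨l, rfl⟩ := Nat.exists_eq_add_of_le hk'
              rw [Nat.add_sub_cancel_left, pow_add, pow_succ,
                show (1 / 8 : ℝ) = 1 / 2 * (1 / 4) by norm_num, mul_pow]
              ring
      rw [← Finset.mul_sum, norm_mul] at h'
      have h4 : ∑ k ∈ Finset.range (n + 1), (1 / 4 : ℝ) ^ k ≤ 4 / 3 := by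
        have := Summable.sum_le_tsum (Finset.range (n + 1)) (fun k _ => by positivity)
          (summable_geometric_of_lt_one (r := (1 / 4 : ℝ)) (by norm_num) (by norm_num))
        rw [tsum_geometric_of_lt_one (by norm_num) (by norm_num)] at this
        norm_num at this ⊢
        exact this
      have hp : (0 : ℝ) < (1 / 2) ^ n := by positivity
      have h5 : ‖poleFreeCoeff y ρ (n + 1)‖ ≤
          ‖slopeCoeff ρ 0‖ * ‖poleFreeCoeff y ρ (n + 1)‖ :=
        le_mul_of_one_le_left (norm_nonneg _) hQ0
      rw [pow_succ]
      nlinarith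

lemma norm_chebPoly_mul_pow_sub_le {y r : ℂ} (hn : ‖y‖ = 1) (hr : ‖r ^ 2‖ ≤ 1)
    (hy : y * (2 * Complex.cosh r - 2) = 1) (n : ℕ) :
    ‖chebPoly n y * (r ^ 2) ^ (n + 1) - r / (y * Complex.sinh r)‖ ≤ (1 / 2) ^ n := by
  have hr0 : r ≠ 0 := fun h => by simp [h] at hy
  have hb (m : ℕ) : ‖poleFreeCoeff y (r ^ 2) m * (r ^ 2) ^ m‖ ≤ (1 / 2) ^ m := by
    rw [norm_mul, norm_pow (r ^ 2)]
    exact (mul_le_of_le_one_right (norm_nonneg _) (pow_le_one₀ (norm_nonneg _) hr)).trans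
      (norm_poleFreeCoeff_le hn hr rfl hy m)
  have hg : Summable fun m : ℕ => (1 / 2 : ℝ) ^ m :=
    summable_geometric_of_lt_one (by norm_num) (by norm_num)
  have hs : Summable fun m => ‖poleFreeCoeff y (r ^ 2) m * (r ^ 2) ^ m‖ :=
    Summable.of_nonneg_of_le (fun _ => norm_nonneg _) hb hg
  have hprod := tsum_mul_tsum_eq_tsum_sum_antidiagonal_of_summable_norm
    (summable_norm_slopeCoeff_mul_pow hr) hs
  have hterm (m : ℕ) : ∑ p ∈ Finset.HasAntidiagonal.antidiagonal m,
      slopeCoeff (r ^ 2) p.1 * (r ^ 2) ^ p.1 * (poleFreeCoeff y (r ^ 2) p.2 * (r ^ 2) ^ p.2) =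
      if m = 0 then y⁻¹ else 0 := by
    have hy0 : y ≠ 0 := fun h0 => by simp [h0] at hn
    have h := sum_slopeCoeff_mul_poleFreeCoeff hr rfl hy m
    have : ∑ p ∈ Finset.HasAntidiagonal.antidiagonal m,
        slopeCoeff (r ^ 2) p.1 * (r ^ 2) ^ p.1 * (poleFreeCoeff y (r ^ 2) p.2 * (r ^ 2) ^ p.2) =
        (r ^ 2) ^ m * ∑ p ∈ Finset.HasAntidiagonal.antidiagonal m,
          slopeCoeff (r ^ 2) p.1 * poleFreeCoeff y (r ^ 2) p.2 := by
      rw [Finset.mul_sum]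
      refine Finset.sum_congr rfl fun p hp => ?_
      rw [← Finset.HasAntidiagonal.mem_antidiagonal.1 hp, pow_add]
      ring
    rw [this]
    split_ifs at h ⊢ with hm
    · subst hm
      rw [pow_zero, one_mul, eq_inv_of_mul_eq_one_right h]
    · rw [(mul_eq_zero.1 h).resolve_left hy0, mul_zero]
  simp_rw [hterm] at hprod
  rw [tsum_ite_eq, tsum_slopeCoeff_mul_pow hr rfl hr0] at hprod
  have hH : ∑' m, poleFreeCoeff y (r ^ 2) m * (r ^ 2) ^ m = r / (y * Complex.sinh r) := by
    have hs0 : Complex.sinh r ≠ 0 := fun h => by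
      rw [h, zero_div, zero_mul] at hprod
      exact inv_ne_zero (fun h0 => by simp [h0] at hn) hprod.symm
    have hy0 : y ≠ 0 := fun h0 => by simp [h0] at hn
    field_simp at hprod ⊢
    linear_combination hprod
  rw [← sum_poleFreeCoeff_mul_pow, ← hH, ← hs.of_norm.sum_add_tsum_nat_add (n + 1),
    sub_add_cancel_left,
    norm_neg]
  have ht : HasSum (fun i : ℕ => (1 / 2 : ℝ) ^ (i + (n + 1))) ((1 / 2) ^ n) := by
    have := (hasSum_geometric_of_lt_one (r := (1 / 2 : ℝ)) (by norm_num) (by norm_num)).mul_right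
      ((1 / 2 : ℝ) ^ (n + 1))
    simp_rw [← pow_add] at this
    rwa [pow_succ, show (1 - 1 / 2 : ℝ)⁻¹ * ((1 / 2) ^ n * (1 / 2)) = (1 / 2) ^ n by
      ring] at this
  exact tsum_of_norm_bounded ht fun i => hb _

lemma exp_ω : Real.exp ω = (3 + √5) / 2 := by
  have h5 : √5 ^ 2 = 5 := Real.sq_sqrt (by norm_num)
  rw [ω, two_mul, Real.exp_add, Real.exp_log (by positivity)]
  linear_combination h5 / 4

lemma cosh_ω : Real.cosh ω = 3 / 2 := by
  have h5 : √5 ^ 2 = 5 := Real.sq_sqrt (by norm_num)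
  rw [Real.cosh_eq, Real.exp_neg, exp_ω]
  have : (3 + √5) / 2 ≠ 0 := by positivity
  field_simp
  linear_combination h5

lemma ω_pos : 0 < ω := by
  have : 1 < (√5 + 1) / 2 := by
    have : 1 < √5 := Real.lt_sqrt_of_sq_lt (by norm_num)
    linarith
  have := Real.log_pos this
  unfold ω
  positivity

lemma ω_lt_one : ω < 1 := by
  have h : Real.exp ω < Real.exp 1 := by
    rw [exp_ω]
    have h1 : √5 < 2.2361 := (Real.sqrt_lt' (by norm_num)).2 (by norm_num)
    have := Real.exp_one_gt_d9
    linarith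
  exact Real.exp_lt_exp.1 h

lemma two_thirds_lt_ω_sq : 2 / 3 < ω ^ 2 := by
  by_contra! h
  have h1 : Real.cosh ω ≤ Real.exp (ω ^ 2 / 2) := Real.cosh_le_exp_half_sq ω
  have h2 : Real.exp (ω ^ 2 / 2) ≤ Real.exp (1 / 3) := Real.exp_le_exp.2 (by linarith)
  have h3 : Real.exp (1 / 3) ^ 3 = Real.exp 1 := by
    rw [← Real.exp_nat_mul]; norm_num
  have h4 := Real.exp_one_lt_d9
  rw [cosh_ω] at h1
  have h5 : (3 / 2 : ℝ) ^ 3 ≤ Real.exp (1 / 3) ^ 3 := by gcongr; linarith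
  norm_num at h5
  linarith

lemma hasSum_coshCoeff_real (ν : ℝ) :
    HasSum (fun k : ℕ => coshCoeff (k + 1) * (ν ^ 2) ^ (k + 1)) (2 * Real.cosh ν - 2) := by
  have := hasSum_coshCoeff (ν : ℂ)
  exact_mod_cast this

lemma chebPoly_succ (n : ℕ) (y : ℂ) :
    chebPoly (n + 1) y =
      y * ∑ i ∈ Finset.range (n + 1), (coshCoeff (i + 1) : ℂ) * chebPoly (n - i) y := by
  rw [chebPoly_renewal, if_neg n.succ_ne_zero, zero_add,
    Finset.Nat.sum_antidiagonal_eq_sum_range_succ (fun i j => (coshCoeff i : ℂ) * chebPoly j y),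
    Finset.sum_range_succ', coshCoeff_zero]
  simp

lemma coshCoeff_one : coshCoeff 1 = 1 := by norm_num [coshCoeff, Nat.factorial]

lemma coshCoeff_two : coshCoeff 2 = 1 / 12 := by norm_num [coshCoeff, Nat.factorial]

lemma chebPoly_zero (y : ℂ) : chebPoly 0 y = 1 := by
  rw [chebPoly_renewal]; simp [coshCoeff_zero]

lemma chebPoly_add_two (n : ℕ) (y : ℂ) :
    chebPoly (n + 2) y = y * (1 / 12 + y) * chebPoly n y +
      ∑ i ∈ Finset.range n, (y * coshCoeff (i + 3) + y ^ 2 * coshCoeff (i + 2)) *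
        chebPoly (n - 1 - i) y := by
  have h1 : chebPoly (n + 1) y = y * (chebPoly n y +
      ∑ i ∈ Finset.range n, (coshCoeff (i + 2) : ℂ) * chebPoly (n - 1 - i) y) := by
    rw [chebPoly_succ, Finset.sum_range_succ', add_comm, zero_add, coshCoeff_one, Nat.sub_zero,
      Complex.ofReal_one, one_mul]
    congr 2
    refine Finset.sum_congr rfl fun i _ => ?_
    rw [show n - (i + 1) = n - 1 - i by omega]
  have h2 : chebPoly (n + 2) y = y * (chebPoly (n + 1) y + 1 / 12 * chebPoly n y +
      ∑ i ∈ Finset.range n, (coshCoeff (i + 3) : ℂ) * chebPoly (n - 1 - i) y) := by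
    have h3 : ∀ i ∈ Finset.range n, (coshCoeff (i + 1 + 1 + 1) : ℂ) *
        chebPoly (n + 1 - (i + 1 + 1)) y = coshCoeff (i + 3) * chebPoly (n - 1 - i) y :=
      fun i _ => by rw [show n + 1 - (i + 1 + 1) = n - 1 - i by omega]
    rw [chebPoly_succ, Finset.sum_range_succ', Finset.sum_range_succ', Finset.sum_congr rfl h3]
    simp only [zero_add, one_add_one_eq_two, coshCoeff_one, coshCoeff_two, Nat.sub_zero,
      Nat.add_sub_cancel]
    push_cast
    ring
  rw [h2, h1]
  simp only [add_mul, Finset.sum_add_distrib, mul_assoc, ← Finset.mul_sum]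
  ring

lemma norm_chebPoly_mul_pow_le {κ ν : ℝ} (hκ : 0 ≤ κ) {y : ℂ} (hy : ‖y‖ = 1)
    (hyκ : ‖(1 / 12 : ℂ) + y‖ ≤ κ)
    (hν : κ * ν ^ 4 + (2 * Real.cosh ν - 2 - ν ^ 2 - ν ^ 4 / 12) +
      ν ^ 2 * (2 * Real.cosh ν - 2 - ν ^ 2) ≤ 1) (n : ℕ) :
    ‖chebPoly n y‖ * (ν ^ 2) ^ n ≤ 1 + ν ^ 2 := by
  have hs2 := (hasSum_nat_add_iff' 1).2 (hasSum_coshCoeff_real ν)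
  have hs3 := (hasSum_nat_add_iff' 2).2 (hasSum_coshCoeff_real ν)
  simp only [Finset.sum_range_succ, Finset.sum_range_zero, zero_add, coshCoeff_one, coshCoeff_two,
    one_add_one_eq_two, pow_one] at hs2 hs3
  have hc (k : ℕ) : 0 ≤ coshCoeff k * (ν ^ 2) ^ k := mul_nonneg (coshCoeff_nonneg k) (by positivity)
  induction n using Nat.strong_induction_on with
  | _ n ih =>
    match n with
    | 0 => simp [chebPoly_zero]; positivity
    | 1 => simp [chebPoly_succ, chebPoly_zero, coshCoeff_one, hy]
    | n + 2 =>
      have hterm : ∀ i ∈ Finset.range n,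
          ‖(y * coshCoeff (i + 3) + y ^ 2 * coshCoeff (i + 2)) * chebPoly (n - 1 - i) y‖ *
            (ν ^ 2) ^ (n + 2) ≤ (coshCoeff (i + 1 + 1 + 1) * (ν ^ 2) ^ (i + 1 + 1 + 1) +
              ν ^ 2 * (coshCoeff (i + 1 + 1) * (ν ^ 2) ^ (i + 1 + 1))) * (1 + ν ^ 2) := by
        intro i hi
        have hi' : i < n := Finset.mem_range.1 hi
        have h1 : ‖y * coshCoeff (i + 3) + y ^ 2 * coshCoeff (i + 2)‖ ≤
            coshCoeff (i + 3) + coshCoeff (i + 2) := by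
          refine (norm_add_le _ _).trans (le_of_eq ?_)
          simp [hy, abs_of_nonneg, coshCoeff_nonneg]
        have h2 := ih (n - 1 - i) (by omega)
        have h3 : (ν ^ 2) ^ (n + 2) = (ν ^ 2) ^ (i + 3) * (ν ^ 2) ^ (n - 1 - i) := by
          rw [← pow_add]; congr 1; omega
        rw [norm_mul, h3]
        calc _ = (‖y * coshCoeff (i + 3) + y ^ 2 * coshCoeff (i + 2)‖ * (ν ^ 2) ^ (i + 3)) *
              (‖chebPoly (n - 1 - i) y‖ * (ν ^ 2) ^ (n - 1 - i)) := by ring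
          _ ≤ ((coshCoeff (i + 3) + coshCoeff (i + 2)) * (ν ^ 2) ^ (i + 3)) * (1 + ν ^ 2) := by
            gcongr
            exact mul_nonneg (add_nonneg (coshCoeff_nonneg _) (coshCoeff_nonneg _)) (by positivity)
          _ = _ := by ring
      have hsum := Finset.sum_le_sum hterm
      rw [← Finset.sum_mul, ← Finset.sum_mul, Finset.sum_add_distrib, ← Finset.mul_sum] at hsum
      have hb3 := sum_le_hasSum (Finset.range n) (fun i _ => hc (i + 1 + 1 + 1)) hs3
      have hb2 := sum_le_hasSum (Finset.range n) (fun i _ => hc (i + 1 + 1)) hs2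
      have hmain := ih n (by omega)
      have hfirst : ‖y * (1 / 12 + y) * chebPoly n y‖ * (ν ^ 2) ^ (n + 2) ≤
          κ * ν ^ 4 * (1 + ν ^ 2) := by
        rw [norm_mul, norm_mul, hy, one_mul]
        calc _ = ‖(1 / 12 : ℂ) + y‖ * ν ^ 4 * (‖chebPoly n y‖ * (ν ^ 2) ^ n) := by ring
          _ ≤ _ := by gcongr
      have hν2 : 0 ≤ ν ^ 2 := by positivity
      rw [chebPoly_add_two]
      have htri := mul_le_mul_of_nonneg_right ((norm_add_le (y * (1 / 12 + y) * chebPoly n y)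
        (∑ i ∈ Finset.range n, (y * coshCoeff (i + 3) + y ^ 2 * coshCoeff (i + 2)) *
        chebPoly (n - 1 - i) y)).trans (add_le_add le_rfl (norm_sum_le _ _)))
        (by positivity : 0 ≤ (ν ^ 2) ^ (n + 2))
      have hall := mul_le_mul_of_nonneg_right hν (by positivity : 0 ≤ 1 + ν ^ 2)
      have hb2' := mul_le_mul_of_nonneg_left hb2 hν2
      have hb := mul_le_mul_of_nonneg_right (add_le_add hb3 hb2') (by positivity : 0 ≤ 1 + ν ^ 2)
      refine htri.trans ?_
      rw [add_mul]
      refine (add_le_add hfirst (hsum.trans hb)).trans ?_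
      linarith

lemma norm_chebPoly_le_of_le_abs {δ : ℝ} (hδ : 0 < δ) (hδπ : δ ≤ Real.pi) :
    ∃ K lam : ℝ, 0 ≤ K ∧ 0 < lam ∧ lam < 1 ∧ ∀ θ : ℝ, δ ≤ |θ| → |θ| ≤ Real.pi → ∀ n : ℕ,
      ω ^ (2 * n) * ‖chebPoly n (Complex.exp (θ * Complex.I))‖ ≤ K * lam ^ n := by
  set κ := √(1 + 1 / 144 + Real.cos δ / 6) with hκ
  have hω := ω_pos
  have hκlt : κ < 13 / 12 := by
    rw [hκ, Real.sqrt_lt' (by norm_num)]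
    have : Real.cos δ < 1 := by
      rw [← Real.cos_zero]
      exact Real.cos_lt_cos_of_nonneg_of_le_pi le_rfl hδπ hδ
    linarith
  have hcont : Continuous fun ν : ℝ => κ * ν ^ 4 + (2 * Real.cosh ν - 2 - ν ^ 2 - ν ^ 4 / 12) +
      ν ^ 2 * (2 * Real.cosh ν - 2 - ν ^ 2) := by
    have := Real.continuous_cosh
    fun_prop
  have hlt : κ * ω ^ 4 + (2 * Real.cosh ω - 2 - ω ^ 2 - ω ^ 4 / 12) +
      ω ^ 2 * (2 * Real.cosh ω - 2 - ω ^ 2) < 1 := by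
    rw [cosh_ω]
    have : 0 < ω ^ 4 * (13 / 12 - κ) := mul_pos (by positivity) (by linarith)
    linarith
  obtain ⟨ν, hν, hων⟩ := ((((hcont.tendsto ω).eventually (gt_mem_nhds hlt)).filter_mono
    nhdsWithin_le_nhds).and (self_mem_nhdsWithin (s := Set.Ioi ω))).exists
  have hων : ω < ν := hων
  have hν0 : 0 < ν := hω.trans hων
  refine ⟨1 + ν ^ 2, (ω / ν) ^ 2, by positivity, by positivity, ?_, fun θ h1 h2 n => ?_⟩
  · exact pow_lt_one₀ (by positivity) ((div_lt_one hν0).2 hων) (by norm_num)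
  · have hy : ‖Complex.exp (θ * Complex.I)‖ = 1 := Complex.norm_exp_ofReal_mul_I θ
    have hyκ : ‖(1 / 12 : ℂ) + Complex.exp (θ * Complex.I)‖ ≤ κ := by
      rw [hκ, Complex.norm_def]
      apply Real.sqrt_le_sqrt
      have hcos : Real.cos θ ≤ Real.cos δ := by
        rw [← Real.cos_abs θ]
        exact Real.cos_le_cos_of_nonneg_of_le_pi hδ.le h2 h1
      have e : (1 / 12 : ℂ) = ((1 / 12 : ℝ) : ℂ) := by norm_num
      rw [Complex.normSq_apply, Complex.add_re, Complex.add_im, Complex.exp_ofReal_mul_I_re,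
        Complex.exp_ofReal_mul_I_im, e, Complex.ofReal_re, Complex.ofReal_im]
      linarith [Real.sin_sq_add_cos_sq θ]
    have h := norm_chebPoly_mul_pow_le (Real.sqrt_nonneg _) hy hyκ hν.le n
    rw [← pow_mul (ω / ν), div_pow, mul_div_assoc', le_div_iff₀ (by positivity)]
    have := mul_le_mul_of_nonneg_left h (by positivity : 0 ≤ ω ^ (2 * n))
    rw [← pow_mul] at this
    linarith

open Asymptotics Filter in
lemma isBigO_pow_succ_of_hasDerivAt {f f' : ℂ → ℂ} {k : ℕ}
    (hf : ∀ᶠ u in nhds 0, HasDerivAt f (f' u) u) (h0 : f 0 = 0)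
    (hf' : f' =O[nhds 0] fun u => u ^ k) : f =O[nhds 0] fun u => u ^ (k + 1) := by
  obtain ⟨c, hc⟩ := hf'.bound
  obtain ⟨δ, hδ, hball⟩ := Metric.eventually_nhds_iff_ball.1 (hf.and hc)
  refine IsBigO.of_bound c (Metric.eventually_nhds_iff_ball.2 ⟨δ, hδ, fun u hu => ?_⟩)
  have hsub : Metric.closedBall (0 : ℂ) ‖u‖ ⊆ Metric.ball 0 δ :=
    Metric.closedBall_subset_ball (by simpa using hu)
  by_cases hu0 : u = 0
  · simp [hu0, h0]
  have hc0 : 0 ≤ c := by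
    have := (norm_nonneg _).trans (hball u hu).2
    have hp : 0 < ‖u ^ k‖ := norm_pos_iff.2 (pow_ne_zero k hu0)
    exact nonneg_of_mul_nonneg_left this hp
  have := (convex_closedBall (0 : ℂ) ‖u‖).norm_image_sub_le_of_norm_hasDerivWithin_le
    (f := f) (f' := f') (C := c * ‖u‖ ^ k)
    (fun z hz => (hball z (hsub hz)).1.hasDerivWithinAt)
    (fun z hz => (hball z (hsub hz)).2.trans (by
      have hz' : ‖z‖ ≤ ‖u‖ := by simpa using hz
      rw [norm_pow]
      gcongr))
    (Metric.mem_closedBall_self (norm_nonneg u)) (show u ∈ Metric.closedBall 0 ‖u‖ by simp)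
  rw [h0, sub_zero, sub_zero] at this
  rwa [norm_pow, pow_succ, ← mul_assoc]

open Asymptotics Filter in
lemma isBigO_sub_cubic {f₀ f₁ f₂ f₃ : ℂ → ℂ}
    (h₀ : ∀ᶠ u in nhds 0, HasDerivAt f₀ (f₁ u) u) (h₁ : ∀ᶠ u in nhds 0, HasDerivAt f₁ (f₂ u) u)
    (h₂ : ∀ᶠ u in nhds 0, HasDerivAt f₂ (f₃ u) u) (h₃ : DifferentiableAt ℂ f₃ 0) :
    (fun u => f₀ u - (f₀ 0 + f₁ 0 * u + f₂ 0 * u ^ 2 / 2 + f₃ 0 * u ^ 3 / 6)) =O[nhds 0]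
      fun u => u ^ 4 := by
  have e₃ : (fun u => f₃ u - f₃ 0) =O[nhds 0] fun u => u ^ 1 := by
    simpa using h₃.hasDerivAt.isBigO_sub
  have e₂ : (fun u => f₂ u - (f₂ 0 + f₃ 0 * u)) =O[nhds 0] fun u => u ^ 2 := by
    refine isBigO_pow_succ_of_hasDerivAt (h₂.mono fun u hu => ?_) (by simp) e₃
    exact (hu.sub (((hasDerivAt_id u).const_mul (f₃ 0)).const_add (f₂ 0))).congr_deriv (by simp)
  have e₁ : (fun u => f₁ u - (f₁ 0 + f₂ 0 * u + f₃ 0 * u ^ 2 / 2)) =O[nhds 0] fun u => u ^ 3 := by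
    refine isBigO_pow_succ_of_hasDerivAt (h₁.mono fun u hu => ?_) (by simp) e₂
    refine (hu.sub ((((hasDerivAt_id u).const_mul (f₂ 0)).const_add (f₁ 0)).add
      ((((hasDerivAt_id u).pow 2).const_mul (f₃ 0)).div_const 2))).congr_deriv ?_
    simp
    ring
  refine isBigO_pow_succ_of_hasDerivAt (h₀.mono fun u hu => ?_) (by simp) e₁
  refine (hu.sub (((((hasDerivAt_id u).const_mul (f₁ 0)).const_add (f₀ 0)).add
      ((((hasDerivAt_id u).pow 2).const_mul (f₂ 0)).div_const 2)).add
      ((((hasDerivAt_id u).pow 3).const_mul (f₃ 0)).div_const 6))).congr_deriv ?_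
  simp
  ring

/-- A branch of `√(e^{-u} + 4)`. -/
noncomputable def rootSqrt (u : ℂ) : ℂ := Complex.exp (Complex.log (Complex.exp (-u) + 4) / 2)

/-- The solution `r` of `e^u (2 cosh r - 2) = 1` with `r 0 = ω`. -/
noncomputable def root (u : ℂ) : ℂ := 2 * Complex.log ((Complex.exp (-u / 2) + rootSqrt u) / 2)

/-- Minus the derivative of `root`. -/
noncomputable def rootSlope (u : ℂ) : ℂ := Complex.exp (-u / 2) / rootSqrt u

/-- Minus half the logarithmic derivative of `rootSlope`. -/
noncomputable def rootAux (u : ℂ) : ℂ := 1 / (Complex.exp (-u) + 4)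

lemma rootSqrt_ne_zero (u : ℂ) : rootSqrt u ≠ 0 := Complex.exp_ne_zero _

lemma rootSqrt_sq {u : ℂ} (h : Complex.exp (-u) + 4 ≠ 0) :
    rootSqrt u ^ 2 = Complex.exp (-u) + 4 := by
  rw [rootSqrt, ← Complex.exp_nat_mul, Nat.cast_ofNat, mul_div_cancel₀ _ two_ne_zero,
    Complex.exp_log h]

lemma exp_neg_half_sq (u : ℂ) : Complex.exp (-u / 2) ^ 2 = Complex.exp (-u) := by
  rw [← Complex.exp_nat_mul]; congr 1; push_cast; ring

lemma exp_half_root {u : ℂ} (h : Complex.exp (-u) + 4 ≠ 0) :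
    Complex.exp (root u / 2) = (Complex.exp (-u / 2) + rootSqrt u) / 2 ∧
      Complex.exp (-(root u / 2)) = (rootSqrt u - Complex.exp (-u / 2)) / 2 := by
  have hm : (Complex.exp (-u / 2) + rootSqrt u) / 2 *
      ((rootSqrt u - Complex.exp (-u / 2)) / 2) = 1 := by
    linear_combination (rootSqrt_sq h - exp_neg_half_sq u) / 4
  have h1 : Complex.exp (root u / 2) = (Complex.exp (-u / 2) + rootSqrt u) / 2 := by
    rw [root, mul_div_cancel_left₀ _ two_ne_zero, Complex.exp_log (left_ne_zero_of_mul_eq_one hm)]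
  exact ⟨h1, by rw [Complex.exp_neg, h1, inv_eq_of_mul_eq_one_right hm]⟩

lemma exp_mul_cosh_root {u : ℂ} (h : Complex.exp (-u) + 4 ≠ 0) :
    Complex.exp u * (2 * Complex.cosh (root u) - 2) = 1 := by
  obtain ⟨h1, h2⟩ := exp_half_root h
  have e1 : Complex.exp (root u) = Complex.exp (root u / 2) ^ 2 := by
    rw [← Complex.exp_nat_mul]; congr 1; push_cast; ring
  have e2 : Complex.exp (-root u) = Complex.exp (-(root u / 2)) ^ 2 := by
    rw [← Complex.exp_nat_mul]; congr 1; push_cast; ring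
  have e3 : Complex.exp u * Complex.exp (-u) = 1 := by rw [← Complex.exp_add]; simp
  rw [Complex.cosh, e1, e2, h1, h2]
  linear_combination Complex.exp u / 2 * (rootSqrt_sq h + exp_neg_half_sq u) + e3

lemma sinh_root {u : ℂ} (h : Complex.exp (-u) + 4 ≠ 0) :
    Complex.sinh (root u) = Complex.exp (-u / 2) * rootSqrt u / 2 := by
  obtain ⟨h1, h2⟩ := exp_half_root h
  have e1 : Complex.exp (root u) = Complex.exp (root u / 2) ^ 2 := by
    rw [← Complex.exp_nat_mul]; congr 1; push_cast; ring
  have e2 : Complex.exp (-root u) = Complex.exp (-(root u / 2)) ^ 2 := by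
    rw [← Complex.exp_nat_mul]; congr 1; push_cast; ring
  rw [Complex.sinh, e1, e2, h1, h2]
  ring

lemma root_div_mul_sinh {u : ℂ} (h : Complex.exp (-u) + 4 ≠ 0) :
    root u / (Complex.exp u * Complex.sinh (root u)) = 2 * root u * rootSlope u := by
  rw [sinh_root h, rootSlope]
  have := rootSqrt_ne_zero u
  have e3 : Complex.exp u * Complex.exp (-u / 2) ^ 2 = 1 := by
    rw [exp_neg_half_sq, ← Complex.exp_add]; simp
  have h1 := Complex.exp_ne_zero u
  have h2 := Complex.exp_ne_zero (-u / 2)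
  generalize Complex.exp (-u / 2) = v at *
  field_simp
  linear_combination -root u * e3

lemma rootSqrt_zero : rootSqrt 0 = (√5 : ℝ) := by
  rw [rootSqrt, neg_zero, Complex.exp_zero, show (1 : ℂ) + 4 = ((5 : ℝ) : ℂ) by norm_num,
    ← Complex.ofReal_log (by norm_num), Real.sqrt_eq_rpow, Real.rpow_def_of_pos (by norm_num)]
  push_cast
  congr 1
  ring

lemma root_zero : root 0 = ω := by
  rw [root, rootSqrt_zero, neg_zero, zero_div, Complex.exp_zero, ω,
    show ((1 : ℂ) + (√5 : ℝ)) / 2 = (((√5 + 1) / 2 : ℝ) : ℂ) by push_cast; ring,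
    ← Complex.ofReal_log (by positivity)]
  push_cast
  rfl

lemma rootSlope_zero : rootSlope 0 = 1 / (√5 : ℝ) := by
  simp [rootSlope, rootSqrt_zero]

lemma rootAux_zero : rootAux 0 = 1 / 5 := by
  norm_num [rootAux]

lemma hasDerivAt_exp_neg_half (u : ℂ) :
    HasDerivAt (fun u => Complex.exp (-u / 2)) (-Complex.exp (-u / 2) / 2) u := by
  refine (((hasDerivAt_id u).neg.div_const 2).cexp).congr_deriv ?_
  simp
  ring

lemma hasDerivAt_exp_neg_add (u : ℂ) :
    HasDerivAt (fun u => Complex.exp (-u) + 4) (-Complex.exp (-u)) u := by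
  refine (((hasDerivAt_id u).neg.cexp).add_const 4).congr_deriv ?_
  simp

lemma hasDerivAt_rootSqrt {u : ℂ} (h : Complex.exp (-u) + 4 ∈ Complex.slitPlane) :
    HasDerivAt rootSqrt (-Complex.exp (-u) / (2 * rootSqrt u)) u := by
  refine ((((hasDerivAt_exp_neg_add u).clog h).div_const 2).cexp).congr_deriv ?_
  have h0 := Complex.slitPlane_ne_zero h
  change rootSqrt u * _ = _
  have := rootSqrt_ne_zero u
  rw [← rootSqrt_sq h0]
  field_simp

lemma hasDerivAt_rootAux {u : ℂ} (h : Complex.exp (-u) + 4 ∈ Complex.slitPlane) :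
    HasDerivAt rootAux (rootAux u - 4 * rootAux u ^ 2) u := by
  have h0 := Complex.slitPlane_ne_zero h
  refine ((hasDerivAt_const u (1 : ℂ)).div (hasDerivAt_exp_neg_add u) h0).congr_deriv ?_
  rw [rootAux]
  field_simp
  ring

lemma hasDerivAt_rootSlope {u : ℂ} (h : Complex.exp (-u) + 4 ∈ Complex.slitPlane) :
    HasDerivAt rootSlope (-2 * rootAux u * rootSlope u) u := by
  have h0 := Complex.slitPlane_ne_zero h
  refine ((hasDerivAt_exp_neg_half u).div (hasDerivAt_rootSqrt h)
    (rootSqrt_ne_zero u)).congr_deriv ?_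
  have := rootSqrt_ne_zero u
  rw [rootAux, rootSlope, ← rootSqrt_sq h0]
  field_simp
  rw [rootSqrt_sq h0]
  ring

lemma hasDerivAt_root {u : ℂ} (h : Complex.exp (-u) + 4 ∈ Complex.slitPlane)
    (h' : (Complex.exp (-u / 2) + rootSqrt u) / 2 ∈ Complex.slitPlane) :
    HasDerivAt root (-rootSlope u) u := by
  refine (((((hasDerivAt_exp_neg_half u).add (hasDerivAt_rootSqrt h)).div_const 2).clog
    h').const_mul 2).congr_deriv ?_
  have h0 := Complex.slitPlane_ne_zero h'
  have := rootSqrt_ne_zero u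
  have h0' : Complex.exp (-u / 2) + rootSqrt u ≠ 0 := by
    intro h; simp [h] at h0
  simp only [Pi.add_apply]
  rw [rootSlope, ← exp_neg_half_sq]
  generalize Complex.exp (-u / 2) = v at *
  field_simp
  ring

/-- The third cumulant of the distribution proportional to `j ↦ (2j)! {n j}_{1/2}`, up to an
exponentially small error. -/
noncomputable def thirdCumulant (n : ℕ) : ℝ :=
  (2 * n + 1) * (2 / (25 * √5 * ω) - 6 / (25 * ω ^ 2) + 2 / (5 * √5 * ω ^ 3)) + 6 / 125

lemma eventually_root_regular : ∀ᶠ u in nhds (0 : ℂ),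
    Complex.exp (-u) + 4 ∈ Complex.slitPlane ∧
    (Complex.exp (-u / 2) + rootSqrt u) / 2 ∈ Complex.slitPlane ∧
    root u / ω ∈ Complex.slitPlane ∧ (√5 : ℝ) * rootSlope u ∈ Complex.slitPlane ∧
    ‖root u ^ 2‖ ≤ 1 ∧ 2 / 3 ≤ ‖root u ^ 2‖ := by
  have hω := ω_pos
  have hω1 := ω_lt_one
  have h5 : 0 < √5 := by positivity
  have m1 : Complex.exp (-0) + 4 ∈ Complex.slitPlane := by
    rw [neg_zero, Complex.exp_zero]; left; norm_num
  have m2 : (Complex.exp (-0 / 2) + rootSqrt 0) / 2 ∈ Complex.slitPlane := by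
    rw [neg_zero, zero_div, Complex.exp_zero, rootSqrt_zero,
      show ((1 : ℂ) + (√5 : ℝ)) / 2 = (((1 + √5) / 2 : ℝ) : ℂ) by push_cast; ring,
      Complex.ofReal_mem_slitPlane]
    positivity
  have c1 : ContinuousAt (fun u : ℂ => Complex.exp (-u) + 4) 0 := by fun_prop
  have cS := (hasDerivAt_rootSqrt m1).continuousAt
  have c2 : ContinuousAt (fun u : ℂ => (Complex.exp (-u / 2) + rootSqrt u) / 2) 0 := by fun_prop
  have cr := (hasDerivAt_root m1 m2).continuousAt
  have c3 : ContinuousAt (fun u : ℂ => root u / ω) 0 := by fun_prop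
  have cq := (hasDerivAt_rootSlope m1).continuousAt
  have c4 : ContinuousAt (fun u : ℂ => (√5 : ℝ) * rootSlope u) 0 := by fun_prop
  have c5 : ContinuousAt (fun u : ℂ => ‖root u ^ 2‖) 0 := by fun_prop
  have m3 : root 0 / ω ∈ Complex.slitPlane := by
    rw [root_zero, div_self (by exact_mod_cast hω.ne')]
    exact Complex.one_mem_slitPlane
  have m4 : (√5 : ℝ) * rootSlope 0 ∈ Complex.slitPlane := by
    rw [rootSlope_zero, mul_one_div_cancel (by exact_mod_cast h5.ne')]
    exact Complex.one_mem_slitPlane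
  have m5 : ‖root 0 ^ 2‖ < 1 := by
    rw [root_zero, norm_pow, Complex.norm_real, Real.norm_of_nonneg hω.le]
    exact pow_lt_one₀ hω.le hω1 two_ne_zero
  have m6 : 2 / 3 < ‖root 0 ^ 2‖ := by
    rw [root_zero, norm_pow, Complex.norm_real, Real.norm_of_nonneg hω.le]
    exact two_thirds_lt_ω_sq
  have hs := Complex.isOpen_slitPlane
  filter_upwards [c1.eventually_mem (hs.mem_nhds m1), c2.eventually_mem (hs.mem_nhds m2),
    c3.eventually_mem (hs.mem_nhds m3), c4.eventually_mem (hs.mem_nhds m4),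
    c5.eventually (gt_mem_nhds m5), c5.eventually (lt_mem_nhds m6)] with u h1 h2 h3 h4 h5 h6
  exact ⟨h1, h2, h3, h4, h5.le, h6.le⟩

open Asymptotics in
lemma log_root_expansion :
    (fun u => -Complex.log (root u / ω) -
      ((1 / (√5 * ω) : ℝ) * u + (1 / (5 * ω ^ 2) - 2 / (5 * √5 * ω) : ℝ) * u ^ 2 / 2 +
        (2 / (25 * √5 * ω) - 6 / (25 * ω ^ 2) + 2 / (5 * √5 * ω ^ 3) : ℝ) * u ^ 3 / 6))
      =O[nhds 0] fun u => u ^ 4 := by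
  have hω0 : (ω : ℂ) ≠ 0 := by exact_mod_cast ω_pos.ne'
  have hreg := eventually_root_regular
  have hr0 : ∀ {u : ℂ}, root u / ω ∈ Complex.slitPlane → root u ≠ 0 := fun h h0 => by
    simp [h0] at h
  have h := isBigO_sub_cubic
    (f₀ := fun u => -Complex.log (root u / ω))
    (f₁ := fun u => rootSlope u / root u)
    (f₂ := fun u => -2 * rootAux u * (rootSlope u / root u) + (rootSlope u / root u) ^ 2)
    (f₃ := fun u => (-2 * rootAux u + 12 * rootAux u ^ 2) * (rootSlope u / root u) -
      6 * rootAux u * (rootSlope u / root u) ^ 2 + 2 * (rootSlope u / root u) ^ 3)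
    (hreg.mono fun u hu => ?_) (hreg.mono fun u hu => ?_) (hreg.mono fun u hu => ?_) ?_
  · refine h.congr_left fun u => ?_
    congr 1
    have h5 : ((√5 : ℝ) : ℂ) ^ 2 = 5 := by
      rw [← Complex.ofReal_pow, Real.sq_sqrt (by norm_num)]; norm_num
    have h50 : ((√5 : ℝ) : ℂ) ≠ 0 := fun h0 => by norm_num [h0] at h5
    have h53 : ((√5 : ℝ) : ℂ) ^ 3 = 5 * (√5 : ℝ) := by rw [pow_succ, h5]
    simp only [root_zero, rootSlope_zero, rootAux_zero, div_self hω0, Complex.log_one]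
    push_cast
    simp only [div_div, div_pow, mul_pow, one_pow, h5, h53]
    field_simp
    ring
  · obtain ⟨h1, h2, h3, -⟩ := hu
    have := hr0 h3
    refine ((((hasDerivAt_root h1 h2).div_const (ω : ℂ)).clog h3).neg).congr_deriv ?_
    field_simp
  · obtain ⟨h1, h2, h3, -⟩ := hu
    have := hr0 h3
    refine ((hasDerivAt_rootSlope h1).div (hasDerivAt_root h1 h2) this).congr_deriv ?_
    field_simp
    ring
  · obtain ⟨h1, h2, h3, -⟩ := hu
    have := hr0 h3
    have hd := (hasDerivAt_rootSlope h1).div (hasDerivAt_root h1 h2) this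
    refine (((((hasDerivAt_rootAux h1).const_mul (-2)).mul hd).add (hd.pow 2))).congr_deriv ?_
    simp only [Pi.div_apply]
    push_cast
    field_simp
    ring
  · obtain ⟨h1, h2, h3, -⟩ := hreg.self_of_nhds
    have := hr0 h3
    have d1 := (hasDerivAt_rootAux h1).differentiableAt
    have d2 := (hasDerivAt_rootSlope h1).differentiableAt
    have d3 := (hasDerivAt_root h1 h2).differentiableAt
    fun_prop (disch := assumption)

open Asymptotics in
lemma log_rootSlope_expansion :
    (fun u => Complex.log ((√5 : ℝ) * rootSlope u) -
      (-(2 / 5) * u + -(2 / 25) * u ^ 2 / 2 + 6 / 125 * u ^ 3 / 6)) =O[nhds 0] fun u => u ^ 4 := by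
  have hreg := eventually_root_regular
  have h5 : ((√5 : ℝ) : ℂ) ≠ 0 := by
    have : 0 < √5 := by positivity
    exact_mod_cast this.ne'
  have h := isBigO_sub_cubic
    (f₀ := fun u => Complex.log ((√5 : ℝ) * rootSlope u))
    (f₁ := fun u => -2 * rootAux u)
    (f₂ := fun u => -2 * (rootAux u - 4 * rootAux u ^ 2))
    (f₃ := fun u => -2 * ((rootAux u - 4 * rootAux u ^ 2) -
      8 * rootAux u * (rootAux u - 4 * rootAux u ^ 2)))
    (hreg.mono fun u hu => ?_) (hreg.mono fun u hu => ?_) (hreg.mono fun u hu => ?_) ?_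
  · refine h.congr_left fun u => ?_
    congr 1
    simp only [rootSlope_zero, rootAux_zero, mul_one_div_cancel h5, Complex.log_one]
    ring
  · obtain ⟨h1, -, -, h4, -⟩ := hu
    have h0 : rootSlope u ≠ 0 := right_ne_zero_of_mul (Complex.slitPlane_ne_zero h4)
    refine (((hasDerivAt_rootSlope h1).const_mul _).clog h4).congr_deriv ?_
    field_simp
  · exact (hasDerivAt_rootAux hu.1).const_mul _
  · refine (((hasDerivAt_rootAux hu.1).sub
      (((hasDerivAt_rootAux hu.1).pow 2).const_mul 4)).const_mul (-2)).congr_deriv ?_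
    push_cast
    ring
  · have d1 := (hasDerivAt_rootAux hreg.self_of_nhds.1).differentiableAt
    fun_prop

/-- The characteristic function of the distribution approximating the normalized
Chebyshev-Stirling numbers. -/
noncomputable def chebChar (n : ℕ) (θ : ℝ) : ℂ :=
  (√5 * ω ^ (2 * n + 1) / 2 : ℝ) * chebPoly n (Complex.exp (θ * Complex.I))

lemma norm_chebChar_sub_le {u : ℂ} (hu : ‖Complex.exp u‖ = 1) (h : Complex.exp (-u) + 4 ≠ 0)
    (h1 : ‖root u ^ 2‖ ≤ 1) (h2 : 2 / 3 ≤ ‖root u ^ 2‖) (n : ℕ) :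
    ‖(√5 * ω ^ (2 * n + 1) / 2 : ℝ) * chebPoly n (Complex.exp u) -
      (√5 : ℝ) * rootSlope u * (ω / root u) ^ (2 * n + 1)‖ ≤ 3 * √5 / 4 * (3 / 4) ^ n := by
  have hb := norm_chebPoly_mul_pow_sub_le hu h1 (exp_mul_cosh_root h) n
  rw [root_div_mul_sinh h] at hb
  have hr : root u ≠ 0 := fun h0 => by norm_num [h0] at h2
  have hω := ω_pos
  have e : ((√5 * ω ^ (2 * n + 1) / 2 : ℝ) : ℂ) * chebPoly n (Complex.exp u) -
      (√5 : ℝ) * rootSlope u * (ω / root u) ^ (2 * n + 1) =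
      (√5 * ω ^ (2 * n + 1) / 2 : ℝ) * (chebPoly n (Complex.exp u) * (root u ^ 2) ^ (n + 1) -
        2 * root u * rootSlope u) / (root u ^ 2) ^ (n + 1) := by
    have : (root u ^ 2) ^ (n + 1) = root u ^ (2 * n + 1) * root u := by ring
    rw [this, div_pow]
    push_cast
    field_simp
  rw [e, norm_div, norm_mul, Complex.norm_real, Real.norm_of_nonneg (by positivity), norm_pow,
    div_le_iff₀ (by positivity)]
  have hω1 : ω ^ (2 * n + 1) ≤ 1 := pow_le_one₀ hω.le ω_lt_one.le
  calc _ ≤ √5 * 1 / 2 * (1 / 2) ^ n := by gcongr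
    _ = 3 * √5 / 4 * (3 / 4) ^ n * (2 / 3) ^ (n + 1) := by
      have : (1 / 2 : ℝ) ^ n = (3 / 4) ^ n * (2 / 3) ^ n := by rw [← mul_pow]; norm_num
      rw [this]
      ring
    _ ≤ _ := by gcongr

lemma chebChar_expansion : ∃ δ K : ℝ, 0 < δ ∧ 0 < K ∧ ∀ θ : ℝ, |θ| ≤ δ → ∀ n : ℕ,
    ∃ R : ℂ, ‖R‖ ≤ K * (2 * n + 1) * θ ^ 4 ∧
      ‖chebChar n θ - Complex.exp (a' n * (θ * Complex.I) + b' n * (θ * Complex.I) ^ 2 / 2 +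
        thirdCumulant n * (θ * Complex.I) ^ 3 / 6 + R)‖ ≤ K * (3 / 4) ^ n := by
  obtain ⟨K₁, hK₁⟩ := log_root_expansion.bound
  obtain ⟨K₂, hK₂⟩ := log_rootSlope_expansion.bound
  obtain ⟨δ, hδ, hball⟩ := Metric.eventually_nhds_iff_ball.1
    ((eventually_root_regular.and hK₁).and hK₂)
  refine ⟨δ / 2, |K₁| + |K₂| + 3 * √5 / 4, by positivity, by positivity, fun θ hθ n => ?_⟩
  have hθn : ‖(θ * Complex.I : ℂ)‖ = |θ| := by simp
  obtain ⟨⟨⟨h1, -, h3, h4, h5, h6⟩, e1⟩, e2⟩ := hball (θ * Complex.I)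
    (by rw [mem_ball_zero_iff, hθn]; linarith)
  set u : ℂ := θ * Complex.I with hu
  rw [norm_pow, hθn, show |θ| ^ 4 = θ ^ 4 from (by decide : Even 4).pow_abs θ] at e1 e2
  set R₁ := -Complex.log (root u / ω) -
      ((1 / (√5 * ω) : ℝ) * u + (1 / (5 * ω ^ 2) - 2 / (5 * √5 * ω) : ℝ) * u ^ 2 / 2 +
        (2 / (25 * √5 * ω) - 6 / (25 * ω ^ 2) + 2 / (5 * √5 * ω ^ 3) : ℝ) * u ^ 3 / 6) with hR₁
  set R₂ := Complex.log ((√5 : ℝ) * rootSlope u) -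
      (-(2 / 5) * u + -(2 / 25) * u ^ 2 / 2 + 6 / 125 * u ^ 3 / 6) with hR₂
  have hθ4 : 0 ≤ θ ^ 4 := by positivity
  refine ⟨(2 * n + 1 : ℕ) * R₁ + R₂, ?_, ?_⟩
  · refine (norm_add_le _ _).trans ?_
    rw [norm_mul, Complex.norm_natCast]
    push_cast
    have e1' : ‖R₁‖ ≤ |K₁| * θ ^ 4 := e1.trans (by gcongr; exact le_abs_self _)
    have e2' : ‖R₂‖ ≤ |K₂| * θ ^ 4 := e2.trans (by gcongr; exact le_abs_self _)
    have h7 : (1 : ℝ) ≤ 2 * n + 1 := by linarith [n.cast_nonneg (α := ℝ)]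
    calc _ ≤ (2 * (n : ℝ) + 1) * (|K₁| * θ ^ 4) + (2 * n + 1) * (|K₂| * θ ^ 4) := by
          gcongr
          exact e2'.trans (le_mul_of_one_le_left (by positivity) h7)
      _ ≤ _ := by
          have : 0 ≤ (2 * (n : ℝ) + 1) * (3 * √5 / 4 * θ ^ 4) := by positivity
          linarith
  · have hexp : Complex.exp (a' n * u + b' n * u ^ 2 / 2 + thirdCumulant n * u ^ 3 / 6 +
        ((2 * n + 1 : ℕ) * R₁ + R₂)) = (√5 : ℝ) * rootSlope u * (ω / root u) ^ (2 * n + 1) := by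
      have : a' n * u + b' n * u ^ 2 / 2 + thirdCumulant n * u ^ 3 / 6 +
          ((2 * n + 1 : ℕ) * R₁ + R₂) = Complex.log ((√5 : ℝ) * rootSlope u) +
          (2 * n + 1 : ℕ) * -Complex.log (root u / ω) := by
        rw [hR₁, hR₂, a', b', thirdCumulant]
        push_cast
        ring
      rw [this, Complex.exp_add, Complex.exp_nat_mul, Complex.exp_neg,
        Complex.exp_log (Complex.slitPlane_ne_zero h3),
        Complex.exp_log (Complex.slitPlane_ne_zero h4), inv_div]
    rw [hexp]
    refine (norm_chebChar_sub_le (Complex.norm_exp_ofReal_mul_I θ)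
      (Complex.slitPlane_ne_zero h1) h5 h6 n).trans ?_
    gcongr
    have := abs_nonneg K₁
    have := abs_nonneg K₂
    linarith

/-- The integrand `θ ^ k exp (-b θ² / 2 - i s θ)` of a Gaussian Fourier integral. -/
noncomputable def gaussianMode (b s : ℝ) (k : ℕ) (θ : ℝ) : ℂ :=
  (θ : ℂ) ^ k * Complex.exp (-(b / 2) * (θ : ℂ) ^ 2 + -(Complex.I * s) * θ + 0)

lemma norm_gaussianMode (b s : ℝ) (k : ℕ) (θ : ℝ) :
    ‖gaussianMode b s k θ‖ = |θ| ^ k * Real.exp (-(b / 2) * θ ^ 2) := by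
  rw [gaussianMode, norm_mul, norm_pow, Complex.norm_real, Real.norm_eq_abs, Complex.norm_exp]
  congr 2
  have : (-(b / 2) * (θ : ℂ) ^ 2 + -(Complex.I * s) * θ + 0) =
      ((-(b / 2) * θ ^ 2 : ℝ) : ℂ) + (-(s * θ) : ℝ) * Complex.I := by
    push_cast
    ring
  rw [this, Complex.add_re, Complex.ofReal_re, Complex.re_ofReal_mul, Complex.I_re, mul_zero,
    add_zero]

lemma integrable_gaussianMode {b : ℝ} (hb : 0 < b) (s : ℝ) (k : ℕ) :
    MeasureTheory.Integrable (gaussianMode b s k) := by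
  have h := integrable_rpow_mul_exp_neg_mul_sq (half_pos hb)
    (s := k) (by linarith [k.cast_nonneg (α := ℝ)])
  refine h.mono (by unfold gaussianMode; fun_prop) (.of_forall fun θ => ?_)
  rw [norm_gaussianMode, norm_mul, Real.rpow_natCast, norm_pow, Real.norm_eq_abs,
    Real.norm_of_nonneg (Real.exp_pos _).le]

lemma hasDerivAt_gaussianMode_zero (b s θ : ℝ) :
    HasDerivAt (gaussianMode b s 0)
      (-b * gaussianMode b s 1 θ - Complex.I * s * gaussianMode b s 0 θ) θ := by
  have h : HasDerivAt (fun t : ℝ => (t : ℂ)) 1 θ := Complex.ofRealCLM.hasDerivAt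
  refine (((((h.pow 2).const_mul (-(b / 2) : ℂ)).add
    (h.const_mul (-(Complex.I * s)))).add_const 0).cexp.const_mul (1 : ℂ)).congr_deriv ?_
    |>.congr_of_eventuallyEq (.of_forall fun t => ?_)
  · simp only [gaussianMode, Pi.add_apply, Pi.pow_apply]
    ring
  · simp [gaussianMode]

lemma hasDerivAt_gaussianMode_succ (b s : ℝ) (k : ℕ) (θ : ℝ) :
    HasDerivAt (gaussianMode b s (k + 1))
      ((k + 1) * gaussianMode b s k θ - b * gaussianMode b s (k + 2) θ -
        Complex.I * s * gaussianMode b s (k + 1) θ) θ := by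
  have h : HasDerivAt (fun t : ℝ => (t : ℂ)) 1 θ := Complex.ofRealCLM.hasDerivAt
  refine ((h.pow (k + 1)).mul (hasDerivAt_gaussianMode_zero b s θ)).congr_deriv ?_
    |>.congr_of_eventuallyEq (.of_forall fun t => ?_)
  · simp only [gaussianMode, Pi.pow_apply]
    push_cast
    ring
  · simp [gaussianMode]

lemma integral_gaussianMode_zero {b : ℝ} (hb : 0 < b) (s : ℝ) :
    ∫ θ, gaussianMode b s 0 θ = (√(2 * Real.pi / b) * Real.exp (-s ^ 2 / (2 * b)) : ℝ) := by
  simp only [gaussianMode, pow_zero, one_mul]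
  rw [integral_cexp_quadratic (by simpa using hb)]
  rw [Real.sqrt_eq_rpow, Complex.ofReal_mul, Complex.ofReal_cpow (by positivity),
    Complex.ofReal_exp]
  have hb' : (b : ℂ) ≠ 0 := by exact_mod_cast hb.ne'
  congr 2
  · push_cast
    field_simp
  · push_cast
    rfl
  · push_cast
    field_simp
    rw [Complex.I_sq]
    ring

lemma integral_gaussianMode_one {b : ℝ} (hb : 0 < b) (s : ℝ) :
    b * ∫ θ, gaussianMode b s 1 θ = -(Complex.I * s * ∫ θ, gaussianMode b s 0 θ) := by
  have h0 := integrable_gaussianMode hb s 0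
  have h1 := integrable_gaussianMode hb s 1
  have h := MeasureTheory.integral_eq_zero_of_hasDerivAt_of_integrable
    (hasDerivAt_gaussianMode_zero b s) ((h1.const_mul _).sub (h0.const_mul _)) h0
  rw [MeasureTheory.integral_sub (h1.const_mul _) (h0.const_mul _),
    MeasureTheory.integral_const_mul,
    MeasureTheory.integral_const_mul] at h
  linear_combination -h

lemma integral_gaussianMode_add_two {b : ℝ} (hb : 0 < b) (s : ℝ) (k : ℕ) :
    b * ∫ θ, gaussianMode b s (k + 2) θ = (k + 1) * (∫ θ, gaussianMode b s k θ) -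
      Complex.I * s * ∫ θ, gaussianMode b s (k + 1) θ := by
  have h0 := integrable_gaussianMode hb s k
  have h1 := integrable_gaussianMode hb s (k + 1)
  have h2 := integrable_gaussianMode hb s (k + 2)
  have h := MeasureTheory.integral_eq_zero_of_hasDerivAt_of_integrable
    (hasDerivAt_gaussianMode_succ b s k)
    (((h0.const_mul _).sub (h2.const_mul _)).sub (h1.const_mul _)) h1
  have h02 : MeasureTheory.Integrable fun θ =>
      (k + 1 : ℂ) * gaussianMode b s k θ - b * gaussianMode b s (k + 2) θ :=
    (h0.const_mul _).sub (h2.const_mul _)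
  rw [MeasureTheory.integral_sub h02 (h1.const_mul _),
    MeasureTheory.integral_sub (h0.const_mul _) (h2.const_mul _),
    MeasureTheory.integral_const_mul, MeasureTheory.integral_const_mul,
    MeasureTheory.integral_const_mul] at h
  linear_combination -h

lemma integral_gaussianMode_three {b : ℝ} (hb : 0 < b) (s : ℝ) :
    ∫ θ, gaussianMode b s 3 θ =
      Complex.I * (s ^ 3 / b ^ 3 - 3 * s / b ^ 2) * ∫ θ, gaussianMode b s 0 θ := by
  have hb' : (b : ℂ) ≠ 0 := by exact_mod_cast hb.ne'
  have h1 := integral_gaussianMode_one hb s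
  have h2 := integral_gaussianMode_add_two hb s 0
  have h3 := integral_gaussianMode_add_two hb s 1
  norm_num at h2 h3
  have hI := Complex.I_sq
  have : (b : ℂ) ^ 3 * (∫ θ, gaussianMode b s 3 θ) =
      Complex.I * (s ^ 3 - 3 * s * b) * ∫ θ, gaussianMode b s 0 θ := by
    linear_combination (b : ℂ) ^ 2 * h3 + (2 * b - s ^ 2) * h1 - Complex.I * s * b * h2 +
      (s ^ 2 * b * (∫ θ, gaussianMode b s 1 θ)) * hI
  field_simp
  linear_combination this

lemma c'_eq (n : ℕ) : c' n = thirdCumulant n * √n / √(b' n) ^ 3 := by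
  have hω := ω_pos
  have h5 : √5 ^ 2 = 5 := Real.sq_sqrt (by norm_num)
  have hs : 0 < √5 := by positivity
  have h : thirdCumulant n = 2 / (125 * ω ^ 3) * ((2 * √5 * ω ^ 2 - 30 * ω + 10 * √5) * (n : ℝ) +
      3 * ω ^ 3 + √5 * ω ^ 2 - 15 * ω + 5 * √5) := by
    rw [thirdCumulant]
    field_simp
    linear_combination (-(2 * n + 1) * (ω ^ 2 * 250 + 1250)) * h5
  rw [h, c', mul_pow, mul_pow]
  field_simp
  ring

/-- The characteristic function of the Edgeworth approximation. -/
noncomputable def edgeworthChar (n : ℕ) (θ : ℝ) : ℂ :=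
  Complex.exp (a' n * (θ * Complex.I) + b' n * (θ * Complex.I) ^ 2 / 2) *
    (1 + thirdCumulant n * (θ * Complex.I) ^ 3 / 6)

lemma edgeworthChar_mul_exp (n : ℕ) (j : ℤ) (θ : ℝ) :
    edgeworthChar n θ * Complex.exp (-(Complex.I * j) * θ) =
      gaussianMode (b' n) (j - a' n) 0 θ +
        -(Complex.I * thirdCumulant n / 6) * gaussianMode (b' n) (j - a' n) 3 θ := by
  have h : Complex.exp (-(b' n / 2) * (θ : ℂ) ^ 2 + -(Complex.I * (j - a' n : ℝ)) * θ + 0) =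
      Complex.exp (a' n * (θ * Complex.I) + b' n * (θ * Complex.I) ^ 2 / 2) *
        Complex.exp (-(Complex.I * j) * θ) := by
    rw [← Complex.exp_add]
    congr 1
    push_cast
    linear_combination (-(b' n) * (θ : ℂ) ^ 2 / 2) * Complex.I_sq
  rw [gaussianMode, gaussianMode, h, edgeworthChar, mul_pow (θ : ℂ) _ 3, Complex.I_pow_three]
  ring

lemma integrable_edgeworthChar_mul_exp {n : ℕ} (hb : 0 < b' n) (j : ℤ) :
    MeasureTheory.Integrable fun θ : ℝ =>
      edgeworthChar n θ * Complex.exp (-(Complex.I * j) * θ) := by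
  simp only [edgeworthChar_mul_exp]
  exact (integrable_gaussianMode hb _ 0).add ((integrable_gaussianMode hb _ 3).const_mul _)

lemma integral_edgeworthChar {n : ℕ} (hn : n ≠ 0) (hb : 0 < b' n) (j : ℤ) :
    (√(b' n) / (2 * Real.pi) : ℝ) *
        ∫ θ : ℝ, edgeworthChar n θ * Complex.exp (-(Complex.I * j) * θ) =
      (1 / √(2 * Real.pi) * Real.exp (-(x n j) ^ 2 / 2) *
        (1 + c' n * ((x n j) ^ 3 - 3 * x n j) / (6 * √n)) : ℝ) := by
  simp only [edgeworthChar_mul_exp]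
  rw [MeasureTheory.integral_add (integrable_gaussianMode hb _ 0)
    ((integrable_gaussianMode hb _ 3).const_mul _), MeasureTheory.integral_const_mul,
    integral_gaussianMode_three hb, integral_gaussianMode_zero hb]
  set β := √(b' n) with hβ
  have hβ0 : 0 < β := Real.sqrt_pos.2 hb
  have hβ2 : b' n = β ^ 2 := (Real.sq_sqrt hb.le).symm
  have hs : (j : ℝ) - a' n = β * x n j := by rw [x, ← hβ]; field_simp
  have hn0 : 0 < √(n : ℝ) := Real.sqrt_pos.2 (by positivity)
  have hπ := Real.pi_pos
  have e1 : -((j : ℝ) - a' n) ^ 2 / (2 * b' n) = -(x n j) ^ 2 / 2 := by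
    rw [hs, hβ2]
    field_simp
  have e2 : √(2 * Real.pi / b' n) = √(2 * Real.pi) / β := Real.sqrt_div (by positivity) _
  have e3 : c' n * ((x n j) ^ 3 - 3 * x n j) / (6 * √n) =
      thirdCumulant n * ((x n j) ^ 3 - 3 * x n j) / (6 * β ^ 3) := by
    rw [c'_eq, ← hβ]
    field_simp
  have e4 : (-(Complex.I * thirdCumulant n / 6) *
      (Complex.I * (((j - a' n : ℝ) : ℂ) ^ 3 / (b' n : ℂ) ^ 3 -
        3 * ((j - a' n : ℝ) : ℂ) / (b' n : ℂ) ^ 2))) =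
      (thirdCumulant n * ((x n j) ^ 3 - 3 * x n j) / (6 * β ^ 3) : ℝ) := by
    rw [hs, hβ2]
    have : (β : ℂ) ≠ 0 := by exact_mod_cast hβ0.ne'
    push_cast
    field_simp
    rw [Complex.I_sq]
    ring
  have e5 : β / (2 * Real.pi) * (√(2 * Real.pi) / β) = 1 / √(2 * Real.pi) := by
    have h2 : √(2 * Real.pi) ^ 2 = 2 * Real.pi := Real.sq_sqrt (by positivity)
    have : 0 < √(2 * Real.pi) := by positivity
    field_simp
    linear_combination h2
  rw [← mul_assoc (-(Complex.I * thirdCumulant n / 6)), e4, e1, e2, e3, ← e5]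
  push_cast
  ring

lemma integral_exp_int_mul (m : ℤ) :
    ∫ θ in -Real.pi..Real.pi, Complex.exp (m * Complex.I * θ) =
      if m = 0 then (2 * Real.pi : ℂ) else 0 := by
  split_ifs with h
  · simp [h]
    ring
  · have hm : (m : ℂ) * Complex.I ≠ 0 := mul_ne_zero (by exact_mod_cast h) Complex.I_ne_zero
    rw [integral_exp_mul_complex hm, div_eq_zero_iff, sub_eq_zero]
    left
    rw [Complex.exp_eq_exp_iff_exists_int]
    exact ⟨m, by push_cast; ring⟩

lemma integral_chebChar (n : ℕ) (j : ℤ) :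
    (√(b' n) / (2 * Real.pi) : ℝ) *
        ∫ θ in -Real.pi..Real.pi, chebChar n θ * Complex.exp (-(Complex.I * j) * θ) =
      normalizedCheb n j := by
  have e : ∀ θ : ℝ, chebChar n θ * Complex.exp (-(Complex.I * j) * θ) =
      ∑ k ∈ Finset.range (n + 1), (√5 * ω ^ (2 * n + 1) / 2 * scaledCheb n k : ℝ) *
        Complex.exp ((k - j : ℤ) * Complex.I * θ) := by
    intro θ
    rw [chebChar, chebPoly, Finset.mul_sum, Finset.sum_mul]
    refine Finset.sum_congr rfl fun k _ => ?_
    rw [← Complex.exp_nat_mul]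
    have : Complex.exp ((k - j : ℤ) * Complex.I * θ) =
        Complex.exp (k * (θ * Complex.I)) * Complex.exp (-(Complex.I * j) * θ) := by
      rw [← Complex.exp_add]
      push_cast
      ring_nf
    rw [this]
    push_cast
    ring
  simp only [e]
  rw [intervalIntegral.integral_finsetSum fun k _ =>
    (by fun_prop : Continuous _).intervalIntegrable _ _]
  simp only [intervalIntegral.integral_const_mul, integral_exp_int_mul, sub_eq_zero]
  have hπ : (Real.pi : ℂ) ≠ 0 := by exact_mod_cast Real.pi_ne_zero
  rw [normalizedCheb]
  split_ifs with hj
  · lift j to ℕ using hj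
    have hsum : ∑ k ∈ Finset.range (n + 1), ((√5 * ω ^ (2 * n + 1) / 2 * scaledCheb n k : ℝ) : ℂ) *
        (if (k : ℤ) = j then 2 * Real.pi else 0 : ℂ) =
        (√5 * ω ^ (2 * n + 1) / 2 * scaledCheb n j : ℝ) * (2 * Real.pi) := by
      simp only [Nat.cast_inj, mul_ite, mul_zero, Finset.sum_ite_eq', Finset.mem_range]
      split_ifs with h
      · rfl
      · rw [scaledCheb_of_lt (by omega)]
        simp
    rw [hsum, Real.sqrt_mul (by norm_num), scaledCheb]
    push_cast
    simp only [Int.toNat_natCast]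
    field_simp
  · rw [Finset.sum_eq_zero fun k _ => ?_]
    · simp
    · rw [if_neg (by omega), mul_zero]

lemma continuous_chebChar (n : ℕ) : Continuous (chebChar n) := by
  unfold chebChar chebPoly
  fun_prop

lemma exists_mul_le_b' : ∃ β > 0, ∃ N : ℕ, ∀ n ≥ N, β * (2 * n + 1) ≤ b' n := by
  have hω := ω_pos
  have hω1 := ω_lt_one
  have h5 : 2 < √5 := Real.lt_sqrt_of_sq_lt (by norm_num)
  have hβ : 0 < 1 / (5 * ω ^ 2) - 2 / (5 * √5 * ω) := by
    rw [sub_pos, div_lt_div_iff₀ (by positivity) (by positivity)]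
    have : 5 * ω * (2 * ω) < 5 * ω * √5 := by gcongr; linarith
    linarith
  obtain ⟨N, hN⟩ := exists_nat_ge (2 / (25 * (1 / (5 * ω ^ 2) - 2 / (5 * √5 * ω))))
  refine ⟨(1 / (5 * ω ^ 2) - 2 / (5 * √5 * ω)) / 2, half_pos hβ, N, fun n hn => ?_⟩
  rw [b']
  set β := 1 / (5 * ω ^ 2) - 2 / (5 * √5 * ω)
  have hn' : (N : ℝ) ≤ n := by exact_mod_cast hn
  rw [div_le_iff₀ (by positivity)] at hN
  have : (N : ℝ) * β ≤ n * β := by gcongr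
  linarith

lemma b'_le (n : ℕ) : b' n ≤ 1 / (5 * ω ^ 2) * (2 * n + 1) := by
  have hω := ω_pos
  rw [b', sub_mul]
  have : 0 ≤ 2 / (5 * √5 * ω) * (2 * (n : ℝ) + 1) := by positivity
  linarith

lemma exists_abs_thirdCumulant_le : ∃ K > 0, ∀ n : ℕ, |thirdCumulant n| ≤ K * (2 * n + 1) := by
  refine ⟨|2 / (25 * √5 * ω) - 6 / (25 * ω ^ 2) + 2 / (5 * √5 * ω ^ 3)| + 6 / 125, by positivity,
    fun n => ?_⟩
  rw [thirdCumulant]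
  refine (abs_add_le _ _).trans ?_
  have h : (0 : ℝ) ≤ 2 * n + 1 := by positivity
  rw [abs_mul, abs_of_nonneg h, abs_of_nonneg (by norm_num : (0 : ℝ) ≤ 6 / 125)]
  linarith [n.cast_nonneg (α := ℝ)]

lemma exists_sq_add_cube_le_exp {γ A B : ℝ} (hγ : 0 < γ) (hA : 0 ≤ A) (hB : 0 ≤ B) :
    ∃ C, 0 ≤ C ∧ ∀ t, 0 ≤ t → A * t ^ 2 + B * t ^ 3 ≤ C * Real.exp (γ * t) := by
  have key : ∀ (k : ℕ) (t : ℝ), 0 ≤ t → t ^ k ≤ k.factorial / γ ^ k * Real.exp (γ * t) := by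
    intro k t ht
    have h := Real.pow_div_factorial_le_exp (γ * t) (by positivity) k
    rw [div_le_iff₀ (by positivity), mul_pow] at h
    rw [div_mul_eq_mul_div, le_div_iff₀ (by positivity)]
    linarith
  refine ⟨A * ((2).factorial / γ ^ 2) + B * ((3).factorial / γ ^ 3), by positivity, fun t ht => ?_⟩
  rw [add_mul, mul_assoc, mul_assoc]
  gcongr
  exacts [key 2 t ht, key 3 t ht]

lemma norm_exp_gaussian (a b θ : ℝ) :
    ‖Complex.exp (a * (θ * Complex.I) + b * (θ * Complex.I) ^ 2 / 2)‖ =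
      Real.exp (-b * θ ^ 2 / 2) := by
  have : (a * (θ * Complex.I) + b * (θ * Complex.I) ^ 2 / 2 : ℂ) =
      ((-b * θ ^ 2 / 2 : ℝ) : ℂ) + (a * θ : ℝ) * Complex.I := by
    push_cast
    rw [mul_pow, Complex.I_sq]
    ring
  rw [Complex.norm_exp, this, Complex.add_re, Complex.ofReal_re, Complex.re_ofReal_mul,
    Complex.I_re, mul_zero, add_zero]

lemma gaussian_exponent_le {β b m : ℝ} (h : β * m ≤ b) (θ : ℝ) :
    -b * θ ^ 2 / 2 ≤ -(β * (m * θ ^ 2) / 2) := by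
  have := mul_le_mul_of_nonneg_right h (sq_nonneg θ)
  linarith

lemma norm_thirdCumulant_mul_le {n : ℕ} {K : ℝ} (h : |thirdCumulant n| ≤ K * (2 * n + 1)) (θ : ℝ) :
    ‖(thirdCumulant n * (θ * Complex.I) ^ 3 / 6 : ℂ)‖ ≤ K * (2 * n + 1) * |θ| ^ 3 := by
  rw [norm_div, norm_mul, norm_pow, norm_mul, Complex.norm_I, Complex.norm_real, Complex.norm_real,
    mul_one, Real.norm_eq_abs, Real.norm_eq_abs]
  have h6 : ‖(6 : ℂ)‖ = 6 := by norm_num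
  rw [h6]
  have : |thirdCumulant n| * |θ| ^ 3 ≤ K * (2 * n + 1) * |θ| ^ 3 := by gcongr
  have : 0 ≤ |thirdCumulant n| * |θ| ^ 3 := by positivity
  linarith

lemma exists_norm_edgeworthChar_le {β δ : ℝ} (hβ : 0 < β) (hδ : 0 < δ) :
    ∃ C, 0 ≤ C ∧ ∀ n : ℕ, β * (2 * n + 1) ≤ b' n → ∀ θ, δ ≤ |θ| →
      ‖edgeworthChar n θ‖ ≤ C / (2 * n + 1) * Real.exp (-(β / 8) * (2 * n + 1) * θ ^ 2) := by
  obtain ⟨K, hK, hκ⟩ := exists_abs_thirdCumulant_le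
  obtain ⟨C, hC, h⟩ := exists_sq_add_cube_le_exp (γ := 3 * β / 8) (A := 1 / δ ^ 4 + K / δ) (B := 0)
    (by positivity) (by positivity) le_rfl
  refine ⟨C, hC, fun n hn θ hθ => ?_⟩
  set m : ℝ := 2 * n + 1 with hm
  have hm1 : 1 ≤ m := by linarith [n.cast_nonneg (α := ℝ)]
  have h1 : ‖(1 + thirdCumulant n * (θ * Complex.I) ^ 3 / 6 : ℂ)‖ ≤ 1 + K * m * |θ| ^ 3 := by
    refine (norm_add_le _ _).trans ?_
    rw [norm_one]
    gcongr
    exact norm_thirdCumulant_mul_le (hκ n) θ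
  have h2 : 1 + K * m * |θ| ^ 3 ≤ (1 / δ ^ 4 + K / δ) * (m * θ ^ 2) ^ 2 / m := by
    have hδ4 : δ ^ 4 ≤ |θ| ^ 4 := by gcongr
    have e : (1 / δ ^ 4 + K / δ) * (m * θ ^ 2) ^ 2 / m =
        m * (|θ| ^ 4 / δ ^ 4) + K * m * (|θ| ^ 3 * (|θ| / δ)) := by
      rw [← sq_abs θ]
      field_simp
    rw [e]
    have : 1 ≤ |θ| ^ 4 / δ ^ 4 := (one_le_div (by positivity)).2 hδ4
    have h3 : 1 ≤ |θ| / δ := (one_le_div hδ).2 hθ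
    gcongr
    · exact one_le_mul_of_one_le_of_one_le hm1 this
    · exact le_mul_of_one_le_right (by positivity) h3
  have h3 := h (m * θ ^ 2) (by positivity)
  rw [zero_mul, add_zero] at h3
  rw [edgeworthChar, norm_mul, norm_exp_gaussian]
  calc _ ≤ Real.exp (-(β * (m * θ ^ 2) / 2)) *
        (C * Real.exp (3 * β / 8 * (m * θ ^ 2)) / m) := by
        gcongr
        · exact gaussian_exponent_le hn θ
        · exact h1.trans (h2.trans (by gcongr))
    _ = C / m * (Real.exp (-(β * (m * θ ^ 2) / 2)) * Real.exp (3 * β / 8 * (m * θ ^ 2))) := by ring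
    _ = _ := by
      rw [← Real.exp_add]
      ring_nf

lemma exists_norm_chebChar_sub_edgeworthChar_le {β : ℝ} (hβ : 0 < β) :
    ∃ δ C, 0 < δ ∧ 0 ≤ C ∧ ∀ n : ℕ, β * (2 * n + 1) ≤ b' n → ∀ θ, |θ| ≤ δ →
      ‖chebChar n θ - edgeworthChar n θ‖ ≤
        C / (2 * n + 1) * Real.exp (-(β / 8) * (2 * n + 1) * θ ^ 2) + C * (3 / 4) ^ n := by
  obtain ⟨δ, K, hδ, hK, hexp⟩ := chebChar_expansion
  obtain ⟨L, hL, hκ⟩ := exists_abs_thirdCumulant_le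
  obtain ⟨C, hC, h⟩ := exists_sq_add_cube_le_exp (γ := β / 8) (A := K) (B := (L + K) ^ 2)
    (by positivity) hK.le (by positivity)
  refine ⟨min δ (min 1 (β / (4 * (L + K)))), C + K, by positivity, by positivity,
    fun n hn θ hθ => ?_⟩
  rw [le_min_iff, le_min_iff, le_div_iff₀ (by positivity)] at hθ
  obtain ⟨hθδ, hθ1, hθβ⟩ := hθ
  obtain ⟨R, hR, hch⟩ := hexp θ hθδ n
  set m : ℝ := 2 * n + 1 with hm
  have hm1 : 1 ≤ m := by linarith [n.cast_nonneg (α := ℝ)]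
  set z₀ : ℂ := thirdCumulant n * (θ * Complex.I) ^ 3 / 6 with hz₀
  set E : ℂ := Complex.exp (a' n * (θ * Complex.I) + b' n * (θ * Complex.I) ^ 2 / 2) with hE
  have hz : ‖z₀ + R‖ ≤ (L + K) * m * |θ| ^ 3 := by
    refine (norm_add_le _ _).trans ?_
    have h1 := norm_thirdCumulant_mul_le (hκ n) θ
    have h2 : K * m * θ ^ 4 ≤ K * m * |θ| ^ 3 := by
      rw [← (by decide : Even 4).pow_abs θ]
      gcongr ?_ * ?_
      exact pow_le_pow_of_le_one (abs_nonneg θ) hθ1 (by norm_num)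
    linarith
  have hz' : ‖z₀ + R‖ ≤ β / 4 * (m * θ ^ 2) := by
    refine hz.trans ?_
    rw [← sq_abs θ]
    have : |θ| * (4 * (L + K)) * (m * |θ| ^ 2) ≤ β * (m * |θ| ^ 2) := by gcongr
    linarith
  have hz2 : ‖z₀ + R‖ ^ 2 ≤ (L + K) ^ 2 * (m * θ ^ 2) ^ 3 / m := by
    calc _ ≤ ((L + K) * m * |θ| ^ 3) ^ 2 := by gcongr
      _ = (L + K) ^ 2 * (m * θ ^ 2) ^ 3 / m := by
        rw [← sq_abs θ]
        field_simp
  have hR' : ‖R‖ ≤ K * (m * θ ^ 2) ^ 2 / m := hR.trans_eq (by field_simp)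
  have htaylor : ‖Complex.exp (z₀ + R) - (1 + z₀)‖ ≤
      (K * (m * θ ^ 2) ^ 2 + (L + K) ^ 2 * (m * θ ^ 2) ^ 3) / m *
        Real.exp (β / 4 * (m * θ ^ 2)) := by
    have h1 := Complex.norm_exp_sub_sum_le_norm_mul_exp (z₀ + R) 2
    have e : Complex.exp (z₀ + R) - (1 + z₀) = (Complex.exp (z₀ + R) -
        ∑ i ∈ Finset.range 2, (z₀ + R) ^ i / i.factorial) + R := by
      simp [Finset.sum_range_succ]
      ring
    rw [e]
    refine (norm_add_le _ _).trans ?_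
    have h2 : 1 ≤ Real.exp (β / 4 * (m * θ ^ 2)) := Real.one_le_exp (by positivity)
    calc _ ≤ (L + K) ^ 2 * (m * θ ^ 2) ^ 3 / m * Real.exp (β / 4 * (m * θ ^ 2)) +
          K * (m * θ ^ 2) ^ 2 / m * Real.exp (β / 4 * (m * θ ^ 2)) := by
          gcongr
          · exact h1.trans (by gcongr)
          · exact hR'.trans (le_mul_of_one_le_right (by positivity) h2)
      _ = _ := by ring
  have hmain : ‖E * (Complex.exp (z₀ + R) - (1 + z₀))‖ ≤
      C / m * Real.exp (-(β / 8) * m * θ ^ 2) := by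
    rw [norm_mul, hE, norm_exp_gaussian]
    have h3 := h (m * θ ^ 2) (by positivity)
    calc _ ≤ Real.exp (-(β * (m * θ ^ 2) / 2)) *
          (C * Real.exp (β / 8 * (m * θ ^ 2)) / m * Real.exp (β / 4 * (m * θ ^ 2))) := by
          gcongr
          · exact gaussian_exponent_le hn θ
          · exact htaylor.trans (by gcongr)
      _ = C / m * (Real.exp (-(β * (m * θ ^ 2) / 2)) * Real.exp (β / 8 * (m * θ ^ 2)) *
            Real.exp (β / 4 * (m * θ ^ 2))) := by ring
      _ = _ := by
        rw [← Real.exp_add, ← Real.exp_add]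
        ring_nf
  have e : chebChar n θ - edgeworthChar n θ =
      (chebChar n θ - Complex.exp (a' n * (θ * Complex.I) + b' n * (θ * Complex.I) ^ 2 / 2 +
        z₀ + R)) + E * (Complex.exp (z₀ + R) - (1 + z₀)) := by
    rw [edgeworthChar, ← hE, ← hz₀, add_assoc _ z₀ R, Complex.exp_add _ (z₀ + R), ← hE]
    ring
  rw [e]
  calc _ ≤ K * (3 / 4) ^ n + C / m * Real.exp (-(β / 8) * m * θ ^ 2) :=
        (norm_add_le _ _).trans (add_le_add hch hmain)
    _ ≤ (C + K) * (3 / 4) ^ n + (C + K) / m * Real.exp (-(β / 8) * m * θ ^ 2) := by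
        gcongr <;> linarith
    _ = _ := add_comm _ _

lemma exists_norm_indicator_sub_edgeworthChar_le {β : ℝ} (hβ : 0 < β) :
    ∃ C D r, 0 ≤ C ∧ 0 ≤ D ∧ 0 < r ∧ r < 1 ∧ ∀ n : ℕ, β * (2 * n + 1) ≤ b' n → ∀ θ,
      ‖(Set.Ioc (-Real.pi) Real.pi).indicator (chebChar n) θ - edgeworthChar n θ‖ ≤
        C / (2 * n + 1) * Real.exp (-(β / 8) * (2 * n + 1) * θ ^ 2) +
          (Set.Ioc (-Real.pi) Real.pi).indicator (fun _ => D * r ^ n) θ := by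
  obtain ⟨δ₀, C₁, hδ₀, hC₁, h₁⟩ := exists_norm_chebChar_sub_edgeworthChar_le hβ
  have hπ := Real.pi_pos
  set δ := min δ₀ Real.pi with hδd
  have hδ : 0 < δ := lt_min hδ₀ hπ
  obtain ⟨C₂, hC₂, h₂⟩ := exists_norm_edgeworthChar_le hβ hδ
  obtain ⟨K, lam, hK, hlam, hlam1, h₃⟩ := norm_chebPoly_le_of_le_abs hδ (min_le_right _ _)
  have hω := ω_pos
  refine ⟨C₁ + C₂, C₁ + √5 * ω / 2 * K, max (3 / 4) lam, by positivity, by positivity,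
    by positivity, max_lt (by norm_num) hlam1, fun n hn θ => ?_⟩
  have hθπ : θ ∈ Set.Ioc (-Real.pi) Real.pi → |θ| ≤ Real.pi := fun h => abs_le.2 ⟨h.1.le, h.2⟩
  by_cases hin : θ ∈ Set.Ioc (-Real.pi) Real.pi
  · rw [Set.indicator_of_mem hin, Set.indicator_of_mem hin]
    rcases le_total |θ| δ with hθ | hθ
    · refine (h₁ n hn θ (hθ.trans (min_le_left _ _))).trans ?_
      gcongr
      · linarith
      · exact le_add_of_nonneg_right (by positivity)
      · exact le_max_left _ _
    · refine (norm_sub_le _ _).trans ?_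
      rw [add_comm]
      have h4 : ‖chebChar n θ‖ ≤ √5 * ω / 2 * K * lam ^ n := by
        rw [chebChar, norm_mul, Complex.norm_real, Real.norm_of_nonneg (by positivity)]
        have := h₃ θ hθ (hθπ hin) n
        calc _ = √5 * ω / 2 * (ω ^ (2 * n) * ‖chebPoly n (Complex.exp (θ * Complex.I))‖) := by ring
          _ ≤ √5 * ω / 2 * (K * lam ^ n) := by gcongr
          _ = _ := by ring
      refine add_le_add ((h₂ n hn θ hθ).trans ?_) (h4.trans ?_)
      · gcongr
        linarith
      · gcongr
        · exact le_add_of_nonneg_left hC₁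
        · exact le_max_right _ _
  · rw [Set.indicator_of_notMem hin, Set.indicator_of_notMem hin, zero_sub, norm_neg, add_zero]
    have hθ : δ ≤ |θ| := by
      by_contra! hlt
      have := abs_lt.1 (hlt.trans_le (min_le_right _ _))
      exact hin ⟨this.1, this.2.le⟩
    refine (h₂ n hn θ hθ).trans ?_
    gcongr
    linarith

lemma abs_normalizedCheb_sub_le {n : ℕ} (hn : n ≠ 0) (hb : 0 < b' n) {A g M : ℝ} (hg : 0 < g)
    (h : ∀ θ, ‖(Set.Ioc (-Real.pi) Real.pi).indicator (chebChar n) θ - edgeworthChar n θ‖ ≤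
      A * Real.exp (-g * θ ^ 2) + (Set.Ioc (-Real.pi) Real.pi).indicator (fun _ => M) θ) (j : ℤ) :
    |normalizedCheb n j - 1 / √(2 * Real.pi) * Real.exp (-(x n j) ^ 2 / 2) *
        (1 + c' n * ((x n j) ^ 3 - 3 * x n j) / (6 * √n))| ≤
      √(b' n) / (2 * Real.pi) * (A * √(Real.pi / g) + 2 * Real.pi * M) := by
  have hπ := Real.pi_pos
  have hle : -Real.pi ≤ Real.pi := by linarith
  set S := Set.Ioc (-Real.pi) Real.pi
  set w : ℝ → ℂ := fun θ => Complex.exp (-(Complex.I * j) * θ) with hw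
  have hw1 : ∀ θ, ‖w θ‖ = 1 := fun θ => by
    have : (-(Complex.I * j) * θ : ℂ) = ((-j * θ : ℝ) : ℂ) * Complex.I := by push_cast; ring
    simp only [hw]
    rw [this, Complex.norm_exp_ofReal_mul_I]
  have hint₁ : MeasureTheory.Integrable (S.indicator fun θ => chebChar n θ * w θ) :=
    (MeasureTheory.integrable_indicator_iff measurableSet_Ioc).2
      ((intervalIntegrable_iff_integrableOn_Ioc_of_le hle).1
        (((continuous_chebChar n).mul (by fun_prop)).intervalIntegrable _ _))
  have hint₂ := integrable_edgeworthChar_mul_exp hb j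
  have hdiff : ((normalizedCheb n j - 1 / √(2 * Real.pi) * Real.exp (-(x n j) ^ 2 / 2) *
      (1 + c' n * ((x n j) ^ 3 - 3 * x n j) / (6 * √n)) : ℝ) : ℂ) =
      (√(b' n) / (2 * Real.pi) : ℝ) *
        ∫ θ, (S.indicator (fun θ => chebChar n θ * w θ) θ - edgeworthChar n θ * w θ) := by
    rw [Complex.ofReal_sub, ← integral_chebChar, ← integral_edgeworthChar hn hb,
      MeasureTheory.integral_sub hint₁ hint₂, MeasureTheory.integral_indicator measurableSet_Ioc,
      intervalIntegral.integral_of_le hle, mul_sub]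
  have hdom₁ : MeasureTheory.Integrable fun θ : ℝ => A * Real.exp (-g * θ ^ 2) :=
    (integrable_exp_neg_mul_sq hg).const_mul A
  have hdom₂ : MeasureTheory.Integrable (S.indicator fun _ => M) :=
    (MeasureTheory.integrable_indicator_iff measurableSet_Ioc).2
      (MeasureTheory.integrableOn_const (by simp))
  rw [← Real.norm_eq_abs, ← Complex.norm_real, hdiff, norm_mul, Complex.norm_real,
    Real.norm_of_nonneg (by positivity)]
  gcongr
  refine (MeasureTheory.norm_integral_le_of_norm_le (hdom₁.add hdom₂)
    (.of_forall fun θ => ?_)).trans_eq ?_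
  · have : S.indicator (fun θ => chebChar n θ * w θ) θ - edgeworthChar n θ * w θ =
        (S.indicator (chebChar n) θ - edgeworthChar n θ) * w θ := by
      rw [sub_mul, Set.indicator_mul_left]
    rw [this, norm_mul, hw1, mul_one]
    exact h θ
  · simp only [Pi.add_apply]
    rw [MeasureTheory.integral_add hdom₁ hdom₂, MeasureTheory.integral_const_mul,
      integral_gaussian, MeasureTheory.integral_indicator measurableSet_Ioc,
      MeasureTheory.setIntegral_const, Real.volume_real_Ioc_of_le hle, smul_eq_mul]
    ring

lemma tendsto_error_bound (B P Q : ℝ) {r : ℝ} (hr : 0 < r) (hr1 : r < 1) :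
    Filter.Tendsto (fun n : ℕ => B * (P / √(2 * n + 1) + Q * ((2 * n + 1) * r ^ n)))
      Filter.atTop (nhds 0) := by
  have h1 := tendsto_self_mul_const_pow_of_lt_one hr.le hr1
  have h2 := tendsto_pow_atTop_nhds_zero_of_lt_one hr.le hr1
  have h3 : Filter.Tendsto (fun n : ℕ => √(2 * (n : ℝ) + 1)) Filter.atTop Filter.atTop :=
    Real.tendsto_sqrt_atTop.comp (Filter.tendsto_atTop_add_const_right _ _
      (tendsto_natCast_atTop_atTop.const_mul_atTop (by norm_num)))
  have h := ((h3.const_div_atTop P).add (((h1.const_mul 2).add h2).const_mul Q)).const_mul B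
  simp only [mul_zero, add_zero] at h
  exact h.congr fun n => by ring

/-- Local central limit theorem for the Chebyshev-Stirling numbers:
uniformly in `j ∈ ℤ`, with `x = (j - a_n')/√(b_n')`,
`√(5 b_n') (2j)! ω^{2n+1} {n j}_{1/2} / (2(2n)!)
  = (1/√(2π)) e^{-x²/2} (1 + c_n' (x³ - 3x)/(6√n)) + o(1/√n)` as `n → ∞`. -/
theorem chebyshevStirling_local_clt :
    ∀ ε > (0 : ℝ), ∃ N : ℕ, ∀ n : ℕ, N ≤ n → ∀ j : ℤ,
      Real.sqrt n *
        |normalizedCheb n j -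
          1 / Real.sqrt (2 * Real.pi) * Real.exp (-(x n j) ^ 2 / 2) *
            (1 + c' n * ((x n j) ^ 3 - 3 * x n j) / (6 * Real.sqrt n))| < ε := by
  intro ε hε
  obtain ⟨β, hβ, N₀, hb⟩ := exists_mul_le_b'
  obtain ⟨C, D, r, hC, hD, hr, hr1, hbound⟩ := exists_norm_indicator_sub_edgeworthChar_le hβ
  have hω := ω_pos
  have hπ := Real.pi_pos
  set B := 1 / (5 * ω ^ 2) with hB
  obtain ⟨N₁, hN₁⟩ := ((tendsto_error_bound (√B / (2 * Real.pi)) (C * √(Real.pi / (β / 8)))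
    (2 * Real.pi * D) hr hr1).eventually_lt_const hε).exists_forall_of_atTop
  refine ⟨max (max N₀ N₁) 1, fun n hn j => ?_⟩
  rw [max_le_iff, max_le_iff] at hn
  obtain ⟨⟨hn0, hn1⟩, hn2⟩ := hn
  refine lt_of_le_of_lt ?_ (hN₁ n hn1)
  have hbn := hb n hn0
  have hb' := b'_le n
  have hpt := hbound n hbn
  set m : ℝ := 2 * n + 1 with hm
  have hm0 : 0 < m := by positivity
  have h := abs_normalizedCheb_sub_le (A := C / m) (g := β / 8 * m) (M := D * r ^ n) (by omega)
    ((mul_pos hβ hm0).trans_le hbn) (by positivity)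
    (fun θ => (hpt θ).trans_eq (by rw [neg_mul (β / 8)])) j
  have h1 : √(n : ℝ) ≤ √m := Real.sqrt_le_sqrt (by rw [hm]; linarith [n.cast_nonneg (α := ℝ)])
  have h2 : √(b' n) ≤ √B * √m := by
    rw [← Real.sqrt_mul (by positivity)]
    exact Real.sqrt_le_sqrt hb'
  have h3 : √(Real.pi / (β / 8 * m)) = √(Real.pi / (β / 8)) / √m := by
    rw [← div_div, Real.sqrt_div (by positivity)]
  have h4 : √m * √m = m := Real.mul_self_sqrt hm0.le
  have h5 : 0 < √m := Real.sqrt_pos.2 hm0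
  calc _ ≤ √m * (√B * √m / (2 * Real.pi) * (C / m * (√(Real.pi / (β / 8)) / √m) +
        2 * Real.pi * (D * r ^ n))) := by
        rw [← h3]
        exact mul_le_mul h1 (h.trans (by gcongr)) (abs_nonneg _) h5.le
    _ = √B / (2 * Real.pi) * (√m * √m) * (C / m * (√(Real.pi / (β / 8)) / √m) +
        2 * Real.pi * (D * r ^ n)) := by ring
    _ = _ := by
      rw [h4]
      field_simp
end
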